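/- For every integer d ≥ 3, if P is a 2-simplicial d-polytope with at most d+3 facets, then either P is a d-simplex (i.e., P has exactly d+1 vertices), or P is a (d−3)-fold pyramid over a 3-polytope with exactly 5 vertices and exactly 6 facets all of whose facets are triangles (a triangular bipyramid). -/

import Mathlib

open Set

/-- A polytope is the convex hull of a finite set of points. -/
def IsPolytope {N : ℕ} (P : Set (Fin N → ℝ)) : Prop :=
  ∃ S : Finset (Fin N → ℝ), P = convexHull ℝ (S : Set (Fin N → ℝ))

/-- The dimension of a set: the dimension of its affine span. -/
noncomputable def pdim {N : ℕ} (P : Set (Fin N → ℝ)) : ℕ :=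
  Module.finrank ℝ (affineSpan ℝ P).direction

/-- A vertex is a 0-dimensional (exposed) face, i.e. an exposed singleton. -/
def IsVertex {N : ℕ} (P : Set (Fin N → ℝ)) (v : Fin N → ℝ) : Prop :=
  IsExposed ℝ P {v}

/-- The set of vertices of `P`. -/
def vertexSet {N : ℕ} (P : Set (Fin N → ℝ)) : Set (Fin N → ℝ) :=
  {v | IsVertex P v}

/-- A facet is a nonempty exposed face of dimension one less than the polytope. -/
def IsFacetOf {N : ℕ} (P F : Set (Fin N → ℝ)) : Prop :=
  IsExposed ℝ P F ∧ F.Nonempty ∧ pdim F + 1 = pdim P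

/-- The set of facets of `P`. -/
def facetSet {N : ℕ} (P : Set (Fin N → ℝ)) : Set (Set (Fin N → ℝ)) :=
  {F | IsFacetOf P F}

/-- A polytope is 2-neighborly if every pair of distinct vertices is the vertex set of
an edge (1-dimensional face), i.e. the segment between them is an exposed face. -/
def TwoNeighborly {N : ℕ} (P : Set (Fin N → ℝ)) : Prop :=
  ∀ u v : Fin N → ℝ, IsVertex P u → IsVertex P v → u ≠ v →
    IsExposed ℝ P (convexHull ℝ {u, v}) ∧ pdim (convexHull ℝ ({u, v} : Set (Fin N → ℝ))) = 1

/-- A polytope is 2-simplicial if every 2-dimensional face has exactly 3 vertices. -/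
def TwoSimplicial {N : ℕ} (P : Set (Fin N → ℝ)) : Prop :=
  ∀ F : Set (Fin N → ℝ), IsExposed ℝ P F → F.Nonempty → pdim F = 2 →
    (vertexSet F).ncard = 3

/-- A polytope is a pyramid if some vertex (the apex) is not in the affine span
of the remaining vertices. -/
def IsPyramid {N : ℕ} (P : Set (Fin N → ℝ)) : Prop :=
  ∃ v : Fin N → ℝ, IsVertex P v ∧ v ∉ affineSpan ℝ (vertexSet P \ {v})

/-- `P` is a pyramid over `Q`: `Q` is a facet of `P` and `P` is the convex hull of `Q`
together with one additional point (the apex) not in the affine span of `Q`. -/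
def IsPyramidOver {N : ℕ} (P Q : Set (Fin N → ℝ)) : Prop :=
  IsFacetOf P Q ∧ ∃ a : Fin N → ℝ, a ∉ affineSpan ℝ Q ∧ P = convexHull ℝ (Q ∪ {a})

/-- `P` is a `k`-fold pyramid over `Q`. -/
def IsKFoldPyramidOver {N : ℕ} : ℕ → Set (Fin N → ℝ) → Set (Fin N → ℝ) → Prop
  | 0, P, Q => P = Q
  | k + 1, P, Q => ∃ R : Set (Fin N → ℝ), IsKFoldPyramidOver k R Q ∧ IsPyramidOver P R

/-- A nonnegative perturbation of a nonnegative vector stays nonnegative for small steps. -/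
theorem exists_pos_forall_nonneg_add_mul {ι : Type*} [Finite ι] (a b : ι → ℝ)
    (ha : ∀ i, 0 ≤ a i) (hb : ∀ i, a i = 0 → 0 ≤ b i) :
    ∃ ε : ℝ, 0 < ε ∧ ∀ i, 0 ≤ a i + ε * b i := by
  have h : ∀ᶠ ε in nhdsWithin (0 : ℝ) (Ioi 0), ∀ i, 0 ≤ a i + ε * b i := by
    rw [Filter.eventually_all]
    intro i
    rcases (ha i).eq_or_lt with h | h
    · filter_upwards [self_mem_nhdsWithin] with ε hε
      have := mul_nonneg (le_of_lt hε) (hb i h.symm)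
      linarith
    · have hc : Filter.Tendsto (fun ε : ℝ => a i + ε * b i) (nhdsWithin 0 (Ioi 0))
          (nhds (a i + 0 * b i)) :=
        (Continuous.tendsto (by fun_prop) 0).mono_left nhdsWithin_le_nhds
      rw [zero_mul, add_zero] at hc
      exact (hc.eventually (lt_mem_nhds h)).mono fun _ h => h.le
  obtain ⟨ε, h1, h2⟩ := (h.and self_mem_nhdsWithin).exists
  exact ⟨ε, h2, h1⟩

/-- The combinatorial properties of the vertex-facet slack matrix of a polytope: rows are vertices,
columns are facets. -/
structure IsSlackMatrix {κ ι : Type*} [Fintype κ] (φ : κ → ι → ℝ) : Prop where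
  nonneg : ∀ k i, 0 ≤ φ k i
  ne_zero : ∀ k, φ k ≠ 0
  cone : ∀ z ∈ Submodule.span ℝ (range φ), (∀ i, 0 ≤ z i) →
    ∃ c : κ → ℝ, (∀ k, 0 ≤ c k) ∧ z = ∑ k, c k • φ k
  minimal : ∀ u v, (∀ i, φ v i = 0 → φ u i = 0) → u = v
  irredundant : ∀ i j, i ≠ j → ∃ k, φ k i ≠ 0 ∧ φ k j = 0

/-- Every three-dimensional face of the cone spanned by the rows has exactly three rays. -/
def TriangularFaces {κ ι : Type*} (φ : κ → ι → ℝ) : Prop :=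
  ∀ T : Set ι, Module.finrank ℝ (Submodule.span ℝ (φ '' {k | ∀ i, i ∉ T → φ k i = 0})) = 3 →
    {k | ∀ i, i ∉ T → φ k i = 0}.ncard = 3

namespace IsSlackMatrix

variable {κ ι : Type*} {φ : κ → ι → ℝ}

theorem mem_span (φ : κ → ι → ℝ) (k : κ) : φ k ∈ Submodule.span ℝ (range φ) :=
  Submodule.subset_span ⟨k, rfl⟩

variable {v : κ} {w : {i // φ v i = 0} → κ}

theorem neighbor_ne (hw : ∀ i, φ (w i) i ≠ 0) (i : {i // φ v i = 0}) : w i ≠ v := by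
  intro he
  have := hw i
  rw [he] at this
  exact this i.2

theorem neighbor_injective (hw : ∀ i, φ (w i) i ≠ 0)
    (hw0 : ∀ i j : {i // φ v i = 0}, j ≠ i → φ (w i) j = 0) : Function.Injective w := by
  intro i j he
  by_contra hne
  have := hw0 i j (Ne.symm hne)
  rw [he] at this
  exact hw j this

variable [Fintype κ]

theorem exists_conic (h : IsSlackMatrix φ) {z : ι → ℝ} (hz : z ∈ Submodule.span ℝ (range φ))
    (hz0 : ∀ i, 0 ≤ z i) :
    ∃ c : κ → ℝ, (∀ k, 0 ≤ c k) ∧ z = ∑ k, c k • φ k ∧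
      ∀ k, c k ≠ 0 → ∀ j, z j = 0 → φ k j = 0 := by
  obtain ⟨c, hc, rfl⟩ := h.cone z hz hz0
  refine ⟨c, hc, rfl, fun k hk j hj => ?_⟩
  simp only [Finset.sum_apply, Pi.smul_apply, smul_eq_mul] at hj
  have := (Finset.sum_eq_zero_iff_of_nonneg fun k _ => mul_nonneg (hc k) (h.nonneg k j)).1 hj k
    (Finset.mem_univ k)
  exact (mul_eq_zero.1 this).resolve_left hk

theorem exists_row (h : IsSlackMatrix φ) {z : ι → ℝ} (hz : z ∈ Submodule.span ℝ (range φ))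
    (hz0 : ∀ i, 0 ≤ z i) {i : ι} (hi : z i ≠ 0) :
    ∃ k, φ k i ≠ 0 ∧ ∀ j, z j = 0 → φ k j = 0 := by
  obtain ⟨c, -, hs, hc⟩ := h.exists_conic hz hz0
  rw [hs, Finset.sum_apply] at hi
  obtain ⟨k, -, hk⟩ := Finset.exists_ne_zero_of_sum_ne_zero hi
  simp only [Pi.smul_apply, smul_eq_mul, ne_eq, mul_eq_zero, not_or] at hk
  exact ⟨k, hk.2, hc k hk.1⟩

theorem face_eq_triple (hT : TriangularFaces φ) {T : Set ι} {x y w : κ}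
    (hx : ∀ i, i ∉ T → φ x i = 0) (hy : ∀ i, i ∉ T → φ y i = 0) (hw : ∀ i, i ∉ T → φ w i = 0)
    (hli : ∀ a b c : ℝ, a • φ x + b • φ y + c • φ w = 0 → a = 0 ∧ b = 0 ∧ c = 0)
    (hsp : ∀ z ∈ Submodule.span ℝ (range φ), (∀ i, i ∉ T → z i = 0) →
      ∃ a b c : ℝ, z = a • φ x + b • φ y + c • φ w) {k : κ} (hk : ∀ i, i ∉ T → φ k i = 0) :
    k = x ∨ k = y ∨ k = w := by
  have hxy : x ≠ y := by
    rintro rfl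
    simpa using (hli 1 (-1) 0 (by simp)).1
  have hxw : x ≠ w := by
    rintro rfl
    simpa using (hli 1 0 (-1) (by simp)).1
  have hyw : y ≠ w := by
    rintro rfl
    simpa using (hli 0 1 (-1) (by simp)).2.1
  have hli' : LinearIndependent ℝ ![φ x, φ y, φ w] := by
    rw [Fintype.linearIndependent_iff]
    intro g hg
    rw [Fin.sum_univ_three] at hg
    obtain ⟨h0, h1, h2⟩ := hli _ _ _ hg
    intro i
    fin_cases i
    exacts [h0, h1, h2]
  have hspan : Submodule.span ℝ (φ '' {k | ∀ i, i ∉ T → φ k i = 0}) =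
      Submodule.span ℝ (range ![φ x, φ y, φ w]) := by
    apply le_antisymm
    · rw [Submodule.span_le]
      rintro _ ⟨k, hk, rfl⟩
      obtain ⟨a, b, c, he⟩ := hsp _ (mem_span φ k) hk
      rw [SetLike.mem_coe, he]
      exact Submodule.add_mem _ (Submodule.add_mem _
        (Submodule.smul_mem _ _ (Submodule.subset_span ⟨0, rfl⟩))
        (Submodule.smul_mem _ _ (Submodule.subset_span ⟨1, rfl⟩)))
        (Submodule.smul_mem _ _ (Submodule.subset_span ⟨2, rfl⟩))
    · apply Submodule.span_mono
      rintro _ ⟨i, rfl⟩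
      fin_cases i
      exacts [⟨x, hx, rfl⟩, ⟨y, hy, rfl⟩, ⟨w, hw, rfl⟩]
  have hcard := hT T (by rw [hspan, finrank_span_eq_card hli', Fintype.card_fin])
  have hsub : ({x, y, w} : Set κ) ⊆ {k | ∀ i, i ∉ T → φ k i = 0} := by
    rintro _ (rfl | rfl | rfl)
    exacts [hx, hy, hw]
  have h3 : ({x, y, w} : Set κ).ncard = 3 := by
    rw [Set.ncard_insert_of_notMem (by simp [hxy, hxw]), Set.ncard_pair hyw]
  have := Set.eq_of_subset_of_ncard_le hsub (by rw [hcard, h3]) (Set.toFinite _)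
  have hk' : k ∈ ({x, y, w} : Set κ) := this ▸ hk
  simpa using hk'

variable [Fintype ι]

theorem eq_smul_of_support_subset (h : IsSlackMatrix φ) (v : κ) {z : ι → ℝ}
    (hz : z ∈ Submodule.span ℝ (range φ)) (hs : ∀ i, φ v i = 0 → z i = 0) :
    ∃ t : ℝ, z = t • φ v := by
  obtain ⟨ε, hε, hn⟩ := exists_pos_forall_nonneg_add_mul (φ v) z (h.nonneg v)
    fun i hi => (hs i hi).ge
  obtain ⟨c, -, he, hc⟩ := h.exists_conic (z := φ v + ε • z)
    (Submodule.add_mem _ (mem_span φ v) (Submodule.smul_mem _ _ hz)) hn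
  rw [Finset.sum_eq_single v] at he
  · refine ⟨(c v - 1) / ε, ?_⟩
    have : ε • z = (c v - 1) • φ v := by rw [sub_smul, one_smul, ← he]; abel
    rw [div_eq_inv_mul, mul_smul, ← this, smul_smul, inv_mul_cancel₀ hε.ne', one_smul]
  · intro k _ hk
    by_contra hne
    have hck : c k ≠ 0 := fun h0 => hne (by rw [h0, zero_smul])
    exact hk (h.minimal k v fun i hi => hc k hck i (by simp [hi, hs i hi]))
  · simp

/-- The projection of the row space to the coordinates where a given row vanishes. -/
noncomputable def zeroProj (φ : κ → ι → ℝ) (v : κ) :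
    Submodule.span ℝ (range φ) →ₗ[ℝ] ({i // φ v i = 0} → ℝ) :=
  (LinearMap.funLeft ℝ ℝ (Subtype.val : {i // φ v i = 0} → ι)).comp
    (Submodule.subtype _)

theorem finrank_ker_zeroProj_le (h : IsSlackMatrix φ) (v : κ) :
    Module.finrank ℝ (LinearMap.ker (zeroProj φ v)) ≤ 1 := by
  refine finrank_le_one ⟨⟨φ v, mem_span φ v⟩, ?_⟩ ?_
  · ext i
    exact i.2
  · rintro ⟨⟨z, hz⟩, hk⟩
    obtain ⟨t, ht⟩ := h.eq_smul_of_support_subset v hz fun i hi => congrFun hk ⟨i, hi⟩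
    exact ⟨t, by ext1; ext1; exact ht.symm⟩

theorem le_card_zeros (h : IsSlackMatrix φ) (v : κ) {d : ℕ}
    (hr : Module.finrank ℝ (Submodule.span ℝ (range φ)) = d + 1) :
    d ≤ Nat.card {i // φ v i = 0} := by
  classical
  have h1 := LinearMap.finrank_range_add_finrank_ker (zeroProj φ v)
  have h2 := h.finrank_ker_zeroProj_le v
  have h3 := Submodule.finrank_le (LinearMap.range (zeroProj φ v))
  rw [Module.finrank_pi, ← Nat.card_eq_fintype_card] at h3
  omega

theorem zeroProj_surjective (h : IsSlackMatrix φ) {v : κ} {d : ℕ}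
    (hr : Module.finrank ℝ (Submodule.span ℝ (range φ)) = d + 1)
    (hv : Nat.card {i // φ v i = 0} = d) : Function.Surjective (zeroProj φ v) := by
  classical
  have h1 := LinearMap.finrank_range_add_finrank_ker (zeroProj φ v)
  have h2 := h.finrank_ker_zeroProj_le v
  have h3 := Submodule.finrank_le (LinearMap.range (zeroProj φ v))
  have h4 : Module.finrank ℝ ({i // φ v i = 0} → ℝ) = d := by
    rw [Module.finrank_pi, ← Nat.card_eq_fintype_card, hv]
  rw [← LinearMap.range_eq_top]
  exact Submodule.eq_top_of_finrank_eq (by omega)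

/-- A simple row `v` has, for each column `i` where it vanishes, a neighbouring row. -/
theorem exists_neighbor (h : IsSlackMatrix φ) {v : κ} {d : ℕ}
    (hr : Module.finrank ℝ (Submodule.span ℝ (range φ)) = d + 1)
    (hv : Nat.card {i // φ v i = 0} = d) (i : {i // φ v i = 0}) :
    ∃ w, φ w i ≠ 0 ∧ (∀ j : {i // φ v i = 0}, j ≠ i → φ w j = 0) ∧ ∃ c, φ v c ≠ 0 ∧ φ w c = 0 := by
  classical
  obtain ⟨⟨y, hy⟩, hyi⟩ := h.zeroProj_surjective hr hv (Pi.single i 1)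
  have hyj : ∀ j : {i // φ v i = 0}, y j = Pi.single (M := fun _ => ℝ) i 1 j :=
    fun j => congrFun hyi j
  obtain ⟨c₀, hc₀⟩ := Function.ne_iff.1 (h.ne_zero v)
  obtain ⟨c, hc, hmax⟩ := Finset.exists_max_image (Finset.univ.filter fun c => φ v c ≠ 0)
    (fun c => -(y c) / φ v c) ⟨c₀, by simpa using hc₀⟩
  simp only [Finset.mem_filter, Finset.mem_univ, true_and] at hc hmax
  obtain ⟨w, hw, hws⟩ := h.exists_row (z := y + (-(y c) / φ v c) • φ v)
    (Submodule.add_mem _ hy (Submodule.smul_mem _ _ (mem_span φ v))) (i := i) (by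
      intro j
      by_cases hj : φ v j = 0
      · have := hyj ⟨j, hj⟩
        simp only [Pi.single_apply] at this
        simp only [Pi.add_apply, Pi.smul_apply, hj, smul_zero, add_zero, this]
        split_ifs <;> norm_num
      · have hpos : 0 < φ v j := lt_of_le_of_ne (h.nonneg v j) (Ne.symm hj)
        have := hmax j hj
        rw [div_le_iff₀ hpos] at this
        simp only [Pi.add_apply, Pi.smul_apply, smul_eq_mul]
        linarith) (by simp [hyj, i.2])
  refine ⟨w, hw, fun j hj => hws j ?_, c, hc, hws c ?_⟩
  · simp [hyj, j.2, hj]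
  · simp only [Pi.add_apply, Pi.smul_apply, smul_eq_mul]
    field_simp
    ring

section Simple


theorem expansion (h : IsSlackMatrix φ) (hw : ∀ i, φ (w i) i ≠ 0)
    (hw0 : ∀ i j : {i // φ v i = 0}, j ≠ i → φ (w i) j = 0)
    {z : ι → ℝ} (hz : z ∈ Submodule.span ℝ (range φ)) :
    ∃ t : ℝ, z = t • φ v + ∑ i : {i // φ v i = 0}, (z i / φ (w i) i) • φ (w i) := by
  classical
  obtain ⟨t, ht⟩ := h.eq_smul_of_support_subset v
    (z := z - ∑ i : {i // φ v i = 0}, (z i / φ (w i) i) • φ (w i))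
    (Submodule.sub_mem _ hz
      (Submodule.sum_mem _ fun i _ => Submodule.smul_mem _ _ (mem_span φ (w i)))) (by
      intro j hj
      rw [Pi.sub_apply, Finset.sum_apply, Finset.sum_eq_single ⟨j, hj⟩]
      · have := hw ⟨j, hj⟩
        simp only [Pi.smul_apply, smul_eq_mul]
        field_simp
        ring
      · intro i _ hi
        simp [hw0 i ⟨j, hj⟩ hi.symm]
      · simp)
  exact ⟨t, by rw [← ht]; abel⟩

theorem exists_common_zero (h : IsSlackMatrix φ) (hT : TriangularFaces φ)
    (hw : ∀ i, φ (w i) i ≠ 0) (hw0 : ∀ i j : {i // φ v i = 0}, j ≠ i → φ (w i) j = 0)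
    {i j : {i // φ v i = 0}} (hij : i ≠ j) :
    ∃ c, φ v c ≠ 0 ∧ φ (w i) c = 0 ∧ φ (w j) c = 0 := by
  classical
  by_contra! hcon
  have hne : (j : ι) ≠ i := fun he => hij (Subtype.ext he.symm)
  obtain ⟨c₀, hc₀⟩ := Function.ne_iff.1 (h.ne_zero v)
  have hface : ∀ k, (∀ m, m ∉ {m | φ v m ≠ 0} ∪ {(i : ι), (j : ι)} → φ k m = 0) →
      k = v ∨ k = w i ∨ k = w j := by
    intro k hk
    refine face_eq_triple hT (T := {m | φ v m ≠ 0} ∪ {(i : ι), (j : ι)}) ?_ ?_ ?_ ?_ ?_ hk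
    · intro m hm
      by_contra hne
      exact hm (Or.inl hne)
    · intro m hm
      simp only [mem_union, mem_ofPred_eq, mem_insert_iff, mem_singleton_iff, not_or, not_not] at hm
      exact hw0 i ⟨m, hm.1⟩ fun he => hm.2.1 (congrArg Subtype.val he)
    · intro m hm
      simp only [mem_union, mem_ofPred_eq, mem_insert_iff, mem_singleton_iff, not_or, not_not] at hm
      exact hw0 j ⟨m, hm.1⟩ fun he => hm.2.2 (congrArg Subtype.val he)
    · intro a b c he
      have h1 := congrFun he i
      have h2 := congrFun he j
      have h3 := congrFun he c₀
      simp only [Pi.add_apply, Pi.smul_apply, smul_eq_mul, i.2, j.2, hw0 i j hij.symm, hw0 j i hij,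
        Pi.zero_apply, mul_zero, zero_add, add_zero, mul_eq_zero, hw i, hw j, or_false] at h1 h2
      subst h1 h2
      have h3' : a * φ v c₀ = 0 := by simpa using h3
      exact ⟨(mul_eq_zero.1 h3').resolve_right hc₀, rfl, rfl⟩
    · intro z hz hzs
      obtain ⟨t, ht⟩ := h.expansion hw hw0 hz
      refine ⟨t, z i / φ (w i) i, z j / φ (w j) j, ?_⟩
      rw [add_assoc, ← Finset.sum_pair (f := fun i : {i // φ v i = 0} => (z i / φ (w i) i) • φ (w i)) hij]
      rw [Finset.sum_subset (Finset.subset_univ {i, j})]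
      · exact ht
      · intro m _ hm
        simp only [Finset.mem_insert, Finset.mem_singleton, not_or] at hm
        rw [hzs m, zero_div, zero_smul]
        simp only [mem_union, mem_ofPred_eq, m.2, mem_insert_iff, mem_singleton_iff, not_or]
        exact ⟨fun h => h rfl, fun he => hm.1 (Subtype.ext he), fun he => hm.2 (Subtype.ext he)⟩
  obtain ⟨ε, hε, hn⟩ := exists_pos_forall_nonneg_add_mul (φ (w i) + φ (w j)) (-φ v)
    (fun m => add_nonneg (h.nonneg _ _) (h.nonneg _ _)) (by
      intro m hm
      by_cases hvm : φ v m = 0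
      · simp [hvm]
      · have h1 := h.nonneg (w i) m
        have h2 := h.nonneg (w j) m
        rw [Pi.add_apply] at hm
        exact absurd (by linarith) (hcon m hvm (by linarith)))
  obtain ⟨c, hc, he, hs⟩ := h.exists_conic (z := φ (w i) + φ (w j) + ε • -φ v)
    (Submodule.add_mem _ (Submodule.add_mem _ (mem_span φ _) (mem_span φ _))
      (Submodule.smul_mem _ _ (Submodule.neg_mem _ (mem_span φ v)))) hn
  have hzero : ∀ k, k ∉ ({v, w i, w j} : Finset κ) → c k • φ k = 0 := by
    intro k hk
    by_contra hck
    have hck : c k ≠ 0 := fun h0 => hck (by rw [h0, zero_smul])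
    refine hk ?_
    simp only [Finset.mem_insert, Finset.mem_singleton]
    refine hface k fun m hm => hs k hck m ?_
    simp only [mem_union, mem_ofPred_eq, mem_insert_iff, mem_singleton_iff, not_or, not_not] at hm
    simp [hm.1, hw0 i ⟨m, hm.1⟩ fun he => hm.2.1 (congrArg Subtype.val he),
      hw0 j ⟨m, hm.1⟩ fun he => hm.2.2 (congrArg Subtype.val he)]
  rw [← Finset.sum_subset (Finset.subset_univ {v, w i, w j}) fun k _ hk => hzero k hk,
    Finset.sum_insert (by simp [(neighbor_ne hw i).symm, (neighbor_ne hw j).symm]),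
    Finset.sum_pair fun hh => hij (neighbor_injective hw hw0 hh)] at he
  have h1 := congrFun he i
  have h2 := congrFun he j
  have h3 := congrFun he c₀
  simp only [Pi.add_apply, Pi.smul_apply, Pi.neg_apply, smul_eq_mul, i.2, j.2, hw0 i j hij.symm,
    hw0 j i hij, mul_zero, zero_add, add_zero, neg_zero] at h1 h2 h3
  have h1' : c (w i) = 1 := by
    have := hw i
    field_simp at h1
    exact h1.symm
  have h2' : c (w j) = 1 := by
    have := hw j
    field_simp at h2
    exact h2.symm
  rw [h1', h2'] at h3
  have hv0 : 0 < φ v c₀ := lt_of_le_of_ne (h.nonneg v c₀) (Ne.symm hc₀)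
  nlinarith [mul_pos hε hv0, mul_nonneg (hc v) hv0.le]

end Simple

end IsSlackMatrix

namespace IsSlackMatrix

variable {κ ι : Type*} {φ : κ → ι → ℝ} {v : κ} {w : {i // φ v i = 0} → κ}

variable [Fintype κ] [Fintype ι]

/-- If some column meets the support of the simple row `v` but no neighbour of `v`, the rows are
`v` and its neighbours. -/
theorem card_of_common_zero (h : IsSlackMatrix φ) (hw : ∀ i, φ (w i) i ≠ 0)
    (hw0 : ∀ i j : {i // φ v i = 0}, j ≠ i → φ (w i) j = 0) {a : ι} (ha : φ v a ≠ 0)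
    (haw : ∀ i, φ (w i) a = 0) : Fintype.card κ = Nat.card {i // φ v i = 0} + 1 := by
  classical
  have hsurj : ∀ u, u = v ∨ ∃ i, u = w i := by
    intro u
    obtain ⟨t, ht⟩ := h.expansion hw hw0 (mem_span φ u)
    have hua : φ u a = t * φ v a := by
      have := congrFun ht a
      simpa [haw] using this
    by_cases hz : ∀ i : {i // φ v i = 0}, φ u i = 0
    · exact Or.inl (h.minimal u v fun i hi => hz ⟨i, hi⟩)
    · push Not at hz
      obtain ⟨i, hi⟩ := hz
      refine Or.inr ⟨i, (h.minimal (w i) u fun m hm => ?_).symm⟩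
      have ht0 : 0 ≤ t := by
        have h1 := h.nonneg u a
        rw [hua] at h1
        exact nonneg_of_mul_nonneg_left h1 (lt_of_le_of_ne (h.nonneg v a) (Ne.symm ha))
      have hs := congrFun ht m
      rw [hm, Pi.add_apply, Finset.sum_apply] at hs
      have hnn : ∀ i ∈ (Finset.univ : Finset {i // φ v i = 0}),
          0 ≤ ((φ u i / φ (w i) i) • φ (w i)) m :=
        fun i _ => mul_nonneg (div_nonneg (h.nonneg _ _) (h.nonneg _ _)) (h.nonneg _ _)
      have hs0 := Finset.sum_nonneg hnn
      have hv0 : 0 ≤ (t • φ v) m := mul_nonneg ht0 (h.nonneg _ _)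
      have := (Finset.sum_eq_zero_iff_of_nonneg hnn).1 (by linarith) i (Finset.mem_univ i)
      exact (mul_eq_zero.1 this).resolve_left (div_ne_zero hi (hw i))
  let f : Option {i // φ v i = 0} → κ := fun o => o.elim v w
  have hf : Function.Bijective f := by
    constructor
    · rintro (_ | i) (_ | j) he
      · rfl
      · exact absurd he.symm (neighbor_ne hw j)
      · exact absurd he (neighbor_ne hw i)
      · exact congrArg some (neighbor_injective hw hw0 he)
    · intro u
      rcases hsurj u with rfl | ⟨i, rfl⟩
      exacts [⟨none, rfl⟩, ⟨some i, rfl⟩]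
  rw [← Nat.card_eq_fintype_card, ← Nat.card_eq_of_bijective f hf, Nat.card_eq_fintype_card,
    Fintype.card_option, Nat.card_eq_fintype_card]

/-- The combination of `v` with one neighbour `w (g c)` opposite to each `c` in the support
of `v`. -/
theorem exists_opposite (h : IsSlackMatrix φ) (hw : ∀ i, φ (w i) i ≠ 0)
    (hw0 : ∀ i j : {i // φ v i = 0}, j ≠ i → φ (w i) j = 0)
    (g : {c // φ v c ≠ 0} → {i // φ v i = 0})
    (hg : ∀ a c : {c // φ v c ≠ 0}, φ (w (g a)) c ≠ 0 ↔ c = a) :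
    ∃ z ∈ Submodule.span ℝ (range φ), (∀ i, 0 ≤ z i) ∧ (∀ i, z i ≠ 0 ↔ ∃ a, (g a : ι) = i) ∧
      z = ∑ a : {c // φ v c ≠ 0}, (φ v a / φ (w (g a)) a) • φ (w (g a)) - φ v := by
  classical
  have hgi : Function.Injective g := by
    intro a b hab
    have := (hg a a).2 rfl
    rw [hab] at this
    exact (hg b a).1 this
  have hpos : ∀ a : {c // φ v c ≠ 0}, 0 < φ v a / φ (w (g a)) a := fun a =>
    div_pos (lt_of_le_of_ne (h.nonneg _ _) a.2.symm)
      (lt_of_le_of_ne (h.nonneg _ _) ((hg a a).2 rfl).symm)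
  have hval : ∀ i, (∑ a : {c // φ v c ≠ 0}, (φ v a / φ (w (g a)) a) • φ (w (g a)) - φ v) i =
      ∑ a : {c // φ v c ≠ 0}, (if (g a : ι) = i then (φ v a / φ (w (g a)) a) * φ (w (g a)) i else 0) := by
    intro i
    rw [Pi.sub_apply, Finset.sum_apply]
    by_cases hi : φ v i = 0
    · rw [hi, sub_zero]
      refine Finset.sum_congr rfl fun a _ => ?_
      split_ifs with hai
      · rfl
      · rw [Pi.smul_apply, hw0 (g a) ⟨i, hi⟩ fun he => hai (congrArg Subtype.val he).symm,
          smul_zero]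
    · rw [Finset.sum_eq_single ⟨i, hi⟩, Finset.sum_eq_zero]
      · have := (hg ⟨i, hi⟩ ⟨i, hi⟩).2 rfl
        simp only at this
        simp only [Pi.smul_apply, smul_eq_mul]
        field_simp
        ring
      · intro a _
        rw [if_neg]
        intro he
        exact hi (he ▸ (g a).2)
      · intro a _ ha
        have : φ (w (g a)) i = 0 := by
          by_contra hne
          exact ha ((hg a ⟨i, hi⟩).1 hne).symm
        simp [this]
      · simp
  have hterm : ∀ (i : ι) (a : {c // φ v c ≠ 0}), 0 ≤ (if (g a : ι) = i then (φ v a / φ (w (g a)) a) * φ (w (g a)) i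
      else 0) := by
    intro i a
    split_ifs
    · exact mul_nonneg (hpos a).le (h.nonneg _ _)
    · exact le_rfl
  refine ⟨_, ?_, ?_, ?_, rfl⟩
  · exact Submodule.sub_mem _ (Submodule.sum_mem _ fun a _ =>
      Submodule.smul_mem _ _ (mem_span φ _)) (mem_span φ v)
  · intro i
    rw [hval]
    exact Finset.sum_nonneg fun a _ => hterm i a
  · intro i
    rw [hval, ne_eq, Finset.sum_eq_zero_iff_of_nonneg fun a _ => hterm i a]
    push Not
    constructor
    · rintro ⟨a, -, ha⟩
      refine ⟨a, ?_⟩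
      by_contra hne
      exact ha (if_neg hne)
    · rintro ⟨a, rfl⟩
      exact ⟨a, Finset.mem_univ a, by
        rw [if_pos rfl]; exact mul_ne_zero (hpos a).ne' (hw (g a))⟩

/-- A simple row with three nonzero entries whose neighbours are opposite to single columns, with
every column hit exactly once: there are five rows. -/
theorem card_eq_five (h : IsSlackMatrix φ) (hw : ∀ i, φ (w i) i ≠ 0)
    (hw0 : ∀ i j : {i // φ v i = 0}, j ≠ i → φ (w i) j = 0)
    (g : {c // φ v c ≠ 0} ≃ {i // φ v i = 0})
    (hg : ∀ a c : {c // φ v c ≠ 0}, φ (w (g a)) c ≠ 0 ↔ c = a) (hne : Nonempty {i // φ v i = 0}) :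
    Fintype.card κ = Nat.card {i // φ v i = 0} + 2 := by
  classical
  obtain ⟨z, hz, hz0, hzs, hze⟩ := h.exists_opposite hw hw0 g hg
  obtain ⟨i₀⟩ := hne
  obtain ⟨x, hx, hxz⟩ := h.exists_row hz hz0 (i := i₀) ((hzs i₀).2 ⟨g.symm i₀, by simp⟩)
  have hxc : ∀ c, φ v c ≠ 0 → φ x c = 0 := fun c hc => hxz c (by
    by_contra hne
    obtain ⟨a, ha⟩ := (hzs c).1 hne
    exact hc (ha ▸ (g a).2))
  have hsurj : ∀ u, u = v ∨ u = x ∨ ∃ i, u = w i := by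
    intro u
    by_cases hz : ∀ i : {i // φ v i = 0}, φ u i = 0
    · exact Or.inl (h.minimal u v fun i hi => hz ⟨i, hi⟩)
    right
    push Not at hz
    obtain ⟨t, ht⟩ := h.expansion hw hw0 (mem_span φ u)
    have huc : ∀ a : {c // φ v c ≠ 0}, φ u a = t * φ v a +
        φ u (g a) / φ (w (g a)) (g a) * φ (w (g a)) a := by
      intro a
      have := congrFun ht a
      rw [Pi.add_apply, Finset.sum_apply, Finset.sum_eq_single (g a)] at this
      · exact this
      · intro i _ hi
        have : φ (w i) a = 0 := by
          by_contra hne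
          have h1 := (hg (g.symm i) a)
          rw [g.apply_symm_apply] at h1
          exact hi (by rw [h1.1 hne, g.apply_symm_apply])
        simp [this]
      · simp
    rcases lt_or_ge t 0 with htneg | htnn
    · left
      refine (h.minimal x u fun m hm => ?_).symm
      by_cases hvm : φ v m = 0
      · exfalso
        have h1 := huc (g.symm ⟨m, hvm⟩)
        simp only [g.apply_symm_apply, hm, zero_div, zero_mul, add_zero] at h1
        have h2 := h.nonneg u (g.symm ⟨m, hvm⟩)
        have h3 := lt_of_le_of_ne (h.nonneg v (g.symm ⟨m, hvm⟩)) (g.symm ⟨m, hvm⟩).2.symm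
        nlinarith
      · exact hxc m hvm
    · right
      obtain ⟨i, hi⟩ := hz
      refine ⟨i, (h.minimal (w i) u fun m hm => ?_).symm⟩
      have hs := congrFun ht m
      rw [hm, Pi.add_apply, Finset.sum_apply] at hs
      have hnn : ∀ i ∈ (Finset.univ : Finset {i // φ v i = 0}),
          0 ≤ ((φ u i / φ (w i) i) • φ (w i)) m :=
        fun i _ => mul_nonneg (div_nonneg (h.nonneg _ _) (h.nonneg _ _)) (h.nonneg _ _)
      have hs0 := Finset.sum_nonneg hnn
      have hv0 : 0 ≤ (t • φ v) m := mul_nonneg htnn (h.nonneg _ _)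
      have := (Finset.sum_eq_zero_iff_of_nonneg hnn).1 (by linarith) i (Finset.mem_univ i)
      exact (mul_eq_zero.1 this).resolve_left (div_ne_zero hi (hw i))
  have hxv : x ≠ v := by
    rintro rfl
    exact hx i₀.2
  have hxw : ∀ i, x ≠ w i := by
    intro i he
    have h1 := (hg (g.symm i) (g.symm i)).2 rfl
    rw [g.apply_symm_apply, ← he] at h1
    exact h1 (hxc _ (g.symm i).2)
  let f : Option (Option {i // φ v i = 0}) → κ := fun o => o.elim v fun o => o.elim x w
  have hf : Function.Bijective f := by
    constructor
    · rintro (_ | _ | i) (_ | _ | j) he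
      · rfl
      · exact absurd he.symm hxv
      · exact absurd he.symm (neighbor_ne hw j)
      · exact absurd he hxv
      · rfl
      · exact absurd he (hxw j)
      · exact absurd he (neighbor_ne hw i)
      · exact absurd he.symm (hxw i)
      · exact congrArg (fun i => some (some i)) (neighbor_injective hw hw0 he)
    · intro u
      rcases hsurj u with rfl | rfl | ⟨i, rfl⟩
      exacts [⟨none, rfl⟩, ⟨some none, rfl⟩, ⟨some (some i), rfl⟩]
  rw [← Nat.card_eq_fintype_card, ← Nat.card_eq_of_bijective f hf, Nat.card_eq_fintype_card,
    Fintype.card_option, Fintype.card_option, Nat.card_eq_fintype_card]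

end IsSlackMatrix

namespace IsSlackMatrix

variable {κ ι : Type*} {φ : κ → ι → ℝ} {v : κ} {w : {i // φ v i = 0} → κ}

variable [Fintype ι]

theorem card_zeros_add_card_support (φ : κ → ι → ℝ) (v : κ) :
    Nat.card {i // φ v i = 0} + Nat.card {i // φ v i ≠ 0} = Fintype.card ι := by
  classical
  have h1 := Fintype.card_subtype_compl fun i => φ v i = 0
  have h2 := Fintype.card_subtype_le fun i => φ v i = 0
  rw [Nat.card_eq_fintype_card, Nat.card_eq_fintype_card]
  simp only [ne_eq]
  omega

variable [Fintype κ]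

/-- Two neighbours of a simple row opposite to the same column produce a quadrilateral. -/
theorem opposite_injective (h : IsSlackMatrix φ) (hT : TriangularFaces φ)
    (hw : ∀ i, φ (w i) i ≠ 0) (hw0 : ∀ i j : {i // φ v i = 0}, j ≠ i → φ (w i) j = 0)
    (f : {i // φ v i = 0} → {c // φ v c ≠ 0}) (hfs : Function.Surjective f)
    (hf : ∀ (i : {i // φ v i = 0}) (c : {c // φ v c ≠ 0}), φ (w i) c ≠ 0 ↔ c = f i) :
    Function.Injective f := by
  classical
  intro i j hij
  by_contra hne
  obtain ⟨g₀, hg₀⟩ := hfs.hasRightInverse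
  have key : ∀ i' : {i // φ v i = 0}, f i' = f i →
      ∃ g : {c // φ v c ≠ 0} → {i // φ v i = 0}, g (f i) = i' ∧ (∀ b, b ≠ f i → g b = g₀ b) ∧
        ∀ b, f (g b) = b := by
    intro i' hi'
    refine ⟨Function.update g₀ (f i) i', by simp, fun b hb => by simp [hb], fun b => ?_⟩
    by_cases hb : b = f i
    · simp [hb, hi']
    · simp [hb, hg₀ b]
  have hrow : ∀ i' : {i // φ v i = 0}, f i' = f i → ∃ u, φ u i' ≠ 0 ∧
      (∀ c : {c // φ v c ≠ 0}, φ u c = 0) ∧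
      ∀ m : {i // φ v i = 0}, m ≠ i' → (∀ b, b ≠ f i → g₀ b ≠ m) → φ u m = 0 := by
    intro i' hi'
    obtain ⟨g, hg1, hg2, hg3⟩ := key i' hi'
    obtain ⟨z, hz, hz0, hzs, -⟩ := h.exists_opposite hw hw0 g fun a c => by rw [hf, hg3]
    obtain ⟨u, hu, hus⟩ := h.exists_row hz hz0 (i := i') ((hzs i').2 ⟨f i, by rw [hg1]⟩)
    refine ⟨u, hu, fun c => hus c ?_, fun m hm hb => hus m ?_⟩
    · by_contra hne
      obtain ⟨a, ha⟩ := (hzs c).1 hne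
      exact c.2 (ha ▸ (g a).2)
    · by_contra hne
      obtain ⟨a, ha⟩ := (hzs m).1 hne
      have ha : g a = m := Subtype.ext ha
      by_cases haf : a = f i
      · exact hm (by rw [← ha, haf, hg1])
      · exact hb a haf (by rw [← hg2 a haf, ha])
  obtain ⟨u, hui, huC, huZ⟩ := hrow i rfl
  obtain ⟨u', huj', huC', huZ'⟩ := hrow j hij.symm
  have huj : φ u j = 0 := huZ j (Ne.symm hne) fun b hb he => hb (by rw [hij, ← he, hg₀ b])
  have hwi : φ (w i) (f i) ≠ 0 := (hf i _).2 rfl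
  have hwj : φ (w j) (f i) ≠ 0 := (hf j _).2 hij
  set T : Set ι := {m | m = f i ∨ m = i ∨ m = j ∨ ∃ b, b ≠ f i ∧ (g₀ b : ι) = m} with hTdef
  have hTC : ∀ b : {c // φ v c ≠ 0}, b ≠ f i → (b : ι) ∉ T := by
    rintro b hb (hm | hm | hm | ⟨c, -, hm⟩)
    · exact hb (Subtype.ext hm)
    · exact b.2 (hm ▸ i.2)
    · exact b.2 (hm ▸ j.2)
    · exact b.2 (hm ▸ (g₀ c).2)
  have hwT : ∀ i' : {i // φ v i = 0}, f i' = f i → (i' : ι) ∈ T → ∀ m, m ∉ T →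
      φ (w i') m = 0 := by
    intro i' hi' hi'T m hm
    by_cases hv : φ v m = 0
    · exact hw0 i' ⟨m, hv⟩ fun he => hm (by rw [← he] at hi'T; exact hi'T)
    · by_contra hne
      have := (hf i' ⟨m, hv⟩).1 hne
      exact hm (Or.inl (by rw [← hi', ← this]))
  have huT : ∀ (i' : {i // φ v i = 0}) (u : κ), (i' : ι) ∈ T →
      (∀ c : {c // φ v c ≠ 0}, φ u c = 0) →
      (∀ m : {i // φ v i = 0}, m ≠ i' → (∀ b, b ≠ f i → g₀ b ≠ m) → φ u m = 0) →
      ∀ m, m ∉ T → φ u m = 0 := by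
    intro i' u hi' h1 h2 m hm
    by_cases hv : φ v m = 0
    · refine h2 ⟨m, hv⟩ (fun he => hm (by rw [← he] at hi'; exact hi')) fun b hb he => hm ?_
      exact Or.inr (Or.inr (Or.inr ⟨b, hb, by rw [he]⟩))
    · exact h1 ⟨m, hv⟩
  have hiT : (i : ι) ∈ T := Or.inr (Or.inl rfl)
  have hjT : (j : ι) ∈ T := Or.inr (Or.inr (Or.inl rfl))
  have hmem := face_eq_triple hT (T := T) (hwT i rfl hiT) (hwT j hij.symm hjT)
    (huT i u hiT huC huZ) (by
      intro p q r he
      have h1 := congrFun he j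
      have h2 := congrFun he (f i)
      have h3 := congrFun he i
      simp only [Pi.add_apply, Pi.smul_apply, smul_eq_mul, hw0 i j (Ne.symm hne), hw0 j i hne,
        huj, huC, Pi.zero_apply, mul_zero, zero_add, add_zero, mul_eq_zero, hw j,
        or_false] at h1 h2 h3
      subst h1
      simp only [zero_mul, add_zero, mul_eq_zero, hwi, or_false] at h2
      subst h2
      simp only [zero_mul, zero_add, mul_eq_zero, hui, or_false] at h3
      exact ⟨rfl, rfl, h3⟩) (by
      intro z hz hzT
      obtain ⟨t, ht⟩ := h.expansion hw hw0 hz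
      obtain ⟨s, hs⟩ := h.expansion hw hw0 (mem_span φ u)
      have hs0 : s ≠ 0 := by
        intro hs0
        have h1 := congrFun hs (f i)
        rw [hs0, zero_smul, zero_add, huC, Finset.sum_apply] at h1
        have := (Finset.sum_eq_zero_iff_of_nonneg (fun m _ =>
          mul_nonneg (div_nonneg (h.nonneg _ _) (h.nonneg _ _)) (h.nonneg _ _))).1 h1.symm i
          (Finset.mem_univ i)
        exact (mul_ne_zero (div_ne_zero hui (hw i)) hwi) this
      set y := z - (t / s) • φ u with hy
      have hye : y = ∑ m : {i // φ v i = 0}, (y m / φ (w m) m) • φ (w m) := by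
        have h1 : ∑ m : {i // φ v i = 0}, (y m / φ (w m) m) • φ (w m) =
            ∑ m : {i // φ v i = 0}, (z m / φ (w m) m) • φ (w m) -
            (t / s) • ∑ m : {i // φ v i = 0}, (φ u m / φ (w m) m) • φ (w m) := by
          rw [Finset.smul_sum, ← Finset.sum_sub_distrib]
          refine Finset.sum_congr rfl fun m _ => ?_
          rw [smul_smul, ← sub_smul, hy, Pi.sub_apply, Pi.smul_apply, smul_eq_mul, sub_div,
            mul_div_assoc]
        rw [h1, eq_sub_of_add_eq' ht.symm, eq_sub_of_add_eq' hs.symm, smul_sub, smul_smul,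
          div_mul_cancel₀ _ hs0, hy]
        abel
      have hyT : ∀ m, m ∉ T → y m = 0 := fun m hm => by
        rw [hy, Pi.sub_apply, Pi.smul_apply, hzT m hm, huT i u hiT huC huZ m hm]
        simp
      have hyg : ∀ b, b ≠ f i → y (g₀ b) = 0 := by
        intro b hb
        have h1 := congrFun hye b
        rw [hyT b (hTC b hb), Finset.sum_apply, Finset.sum_eq_single (g₀ b)] at h1
        · have h2 : φ (w (g₀ b)) b ≠ 0 := (hf _ _).2 (hg₀ b).symm
          have h3 := hw (g₀ b)
          simpa [h2, h3] using h1.symm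
        · intro m _ hm
          rw [Pi.smul_apply, smul_eq_mul]
          by_cases hmb : f m = b
          · rw [hyT m, zero_div, zero_mul]
            rintro (he | he | he | ⟨c, hc, he⟩)
            · exact (f i).2 (he ▸ m.2)
            · exact hb (by rw [← hmb, Subtype.ext he])
            · exact hb (by rw [← hmb, Subtype.ext he, hij])
            · have he : g₀ c = m := Subtype.ext he
              exact hm (by rw [← he, ← hmb, ← he, hg₀ c])
          · have : φ (w m) b = 0 := by
              by_contra hne
              exact hmb ((hf m b).1 hne).symm
            rw [this, mul_zero]
        · simp
      refine ⟨y i / φ (w i) i, y j / φ (w j) j, t / s, ?_⟩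
      rw [← Finset.sum_pair (f := fun i : {i // φ v i = 0} => (y i / φ (w i) i) • φ (w i)) hne,
        Finset.sum_subset (Finset.subset_univ {i, j}), ← hye, hy, sub_add_cancel]
      intro m _ hm
      simp only [Finset.mem_insert, Finset.mem_singleton, not_or] at hm
      have : y m = 0 := by
        by_cases hmT : (m : ι) ∈ T
        · rcases hmT with he | he | he | ⟨c, hc, he⟩
          · exact absurd (he ▸ m.2) (f i).2
          · exact absurd (Subtype.ext he) hm.1
          · exact absurd (Subtype.ext he) hm.2
          · rw [← he]
            exact hyg c hc
        · exact hyT m hmT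
      rw [this, zero_div, zero_smul]) (huT j u' hjT huC' huZ')
  rcases hmem with rfl | rfl | rfl
  · exact hwi (huC' _)
  · exact hwj (huC' _)
  · exact huj' huj

theorem classification_of_simple (h : IsSlackMatrix φ) (hT : TriangularFaces φ) {d : ℕ}
    (hd : 3 ≤ d) (hr : Module.finrank ℝ (Submodule.span ℝ (range φ)) = d + 1)
    (hcard : Fintype.card ι ≤ d + 3) (hα : ∀ k i, ∃ j, j ≠ i ∧ φ k j ≠ 0)
    (hv : Nat.card {i // φ v i = 0} = d) :
    Fintype.card κ = d + 1 ∨ (d = 3 ∧ Fintype.card ι = 6 ∧ Fintype.card κ = 5) := by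
  classical
  choose w hw hw0 hwc using h.exists_neighbor hr hv
  by_cases hC : ∃ a, φ v a ≠ 0 ∧ ∀ i, φ (w i) a = 0
  · obtain ⟨a, ha, haw⟩ := hC
    exact Or.inl (by rw [h.card_of_common_zero hw hw0 ha haw, hv])
  push Not at hC
  right
  have hsum := card_zeros_add_card_support φ v
  have hC3 : Nat.card {i // φ v i ≠ 0} ≤ 3 := by omega
  have hex : ∀ i, ∃ a : {c // φ v c ≠ 0}, φ (w i) a ≠ 0 := by
    intro i
    obtain ⟨j, hj, hwj⟩ := hα (w i) i
    refine ⟨⟨j, fun hvj => hwj (hw0 i ⟨j, hvj⟩ fun he => hj (congrArg Subtype.val he))⟩, hwj⟩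
  choose f hf using hex
  have huniq : ∀ (i : {i // φ v i = 0}) (c : {c // φ v c ≠ 0}), φ (w i) c ≠ 0 → c = f i := by
    intro i c hc
    by_contra hne
    obtain ⟨e, he, hwe⟩ := hwc i
    obtain ⟨j, hj⟩ := hC e he
    obtain ⟨m, hm, hm1, hm2⟩ := h.exists_common_zero hT hw hw0 (i := i) (j := j) (by
      rintro rfl
      exact hj hwe)
    have h4 : ({c, f i, ⟨e, he⟩, ⟨m, hm⟩} : Finset {c // φ v c ≠ 0}).card = 4 := by
      have h1 : c ≠ ⟨e, he⟩ := by rintro rfl; exact hc hwe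
      have h2 : c ≠ ⟨m, hm⟩ := by rintro rfl; exact hc hm1
      have h3 : f i ≠ ⟨e, he⟩ := by intro hh; exact hf i (by rw [hh]; exact hwe)
      have h4 : f i ≠ ⟨m, hm⟩ := by intro hh; exact hf i (by rw [hh]; exact hm1)
      have h5 : (⟨e, he⟩ : {c // φ v c ≠ 0}) ≠ ⟨m, hm⟩ := by
        intro hh
        rw [Subtype.mk.injEq] at hh
        exact hj (by rw [hh]; exact hm2)
      rw [Finset.card_insert_of_notMem (by simp [hne, h1, h2]),
        Finset.card_insert_of_notMem (by simp [h3, h4]), Finset.card_pair h5]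
    have := Finset.card_le_univ ({c, f i, ⟨e, he⟩, ⟨m, hm⟩} : Finset {c // φ v c ≠ 0})
    rw [← Nat.card_eq_fintype_card] at this
    omega
  have hiff : ∀ (i : {i // φ v i = 0}) (c : {c // φ v c ≠ 0}), φ (w i) c ≠ 0 ↔ c = f i :=
    fun i c => ⟨huniq i c, fun he => he ▸ hf i⟩
  have hfs : Function.Surjective f := by
    intro a
    obtain ⟨i, hi⟩ := hC a a.2
    exact ⟨i, (huniq i a hi).symm⟩
  have hne : Nonempty {i // φ v i = 0} := (Nat.card_pos_iff.1 (by omega)).1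
  have hcard3 : 3 ≤ Nat.card {i // φ v i ≠ 0} := by
    obtain ⟨i⟩ := hne
    obtain ⟨e, he, hwe⟩ := hwc i
    obtain ⟨j, hj⟩ := hC e he
    obtain ⟨m, hm, hm1, hm2⟩ := h.exists_common_zero hT hw hw0 (i := i) (j := j) (by
      rintro rfl
      exact hj hwe)
    have h4 : ({f i, ⟨e, he⟩, ⟨m, hm⟩} : Finset {c // φ v c ≠ 0}).card = 3 := by
      have h3 : f i ≠ ⟨e, he⟩ := by intro hh; exact hf i (by rw [hh]; exact hwe)
      have h4 : f i ≠ ⟨m, hm⟩ := by intro hh; exact hf i (by rw [hh]; exact hm1)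
      have h5 : (⟨e, he⟩ : {c // φ v c ≠ 0}) ≠ ⟨m, hm⟩ := by
        intro hh
        rw [Subtype.mk.injEq] at hh
        exact hj (by rw [hh]; exact hm2)
      rw [Finset.card_insert_of_notMem (by simp [h3, h4]), Finset.card_pair h5]
    have := Finset.card_le_univ ({f i, ⟨e, he⟩, ⟨m, hm⟩} : Finset {c // φ v c ≠ 0})
    rw [← Nat.card_eq_fintype_card] at this
    omega
  have hfb : Function.Bijective f := ⟨h.opposite_injective hT hw hw0 f hfs hiff, hfs⟩
  have hcd := Nat.card_eq_of_bijective f hfb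
  have h5 := h.card_eq_five hw hw0 (Equiv.ofBijective f hfb).symm (fun a c => by
    rw [hiff, Equiv.ofBijective_apply_symm_apply f hfb a]) hne
  omega

/-- A matrix all of whose rows have exactly two nonzero entries has a quadrilateral face. -/
theorem false_of_forall_support_pair (h : IsSlackMatrix φ) (hT : TriangularFaces φ) (v : κ)
    (hα : ∀ k i, ∃ j, j ≠ i ∧ φ k j ≠ 0)
    (hpair : ∀ k a, φ k a ≠ 0 → ∃ b, b ≠ a ∧ φ k b ≠ 0 ∧ ∀ m, m ≠ a → m ≠ b → φ k m = 0) :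
    False := by
  obtain ⟨a, hva⟩ := Function.ne_iff.1 (h.ne_zero v)
  obtain ⟨b, hba, hvb, hv⟩ := hpair v a hva
  obtain ⟨u, hua, hub⟩ := h.irredundant a b hba.symm
  obtain ⟨c, hca, huc, hu⟩ := hpair u a hua
  obtain ⟨x, hxc, hxa⟩ := h.irredundant c a hca
  obtain ⟨e, hec, hxe, hx⟩ := hpair x c hxc
  have hcb : c ≠ b := by rintro rfl; exact huc hub
  have hea : e ≠ a := by rintro rfl; exact hxe hxa
  have hpos : ∀ {k i}, φ k i ≠ 0 → 0 < φ k i := fun hki =>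
    lt_of_le_of_ne (h.nonneg _ _) (Ne.symm hki)
  have hva' := hpos hva
  have hua' := hpos hua
  have huc' := hpos huc
  have hxc' := hpos hxc
  have hvb' := hpos hvb
  set α := φ v a / φ u a with hαd
  set β := α * φ u c / φ x c with hβd
  have hα0 : 0 < α := div_pos hva' hua'
  have hβ0 : 0 < β := div_pos (mul_pos hα0 huc') hxc'
  set z := φ v - α • φ u + β • φ x with hzd
  have hz : z ∈ Submodule.span ℝ (range φ) :=
    Submodule.add_mem _ (Submodule.sub_mem _ (mem_span φ v) (Submodule.smul_mem _ _ (mem_span φ u)))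
      (Submodule.smul_mem _ _ (mem_span φ x))
  have hval : ∀ m, z m = φ v m - α * φ u m + β * φ x m := fun m => rfl
  have hza : z a = 0 := by
    rw [hval, hxa, hαd]
    field_simp
    ring
  have hzc : z c = 0 := by
    rw [hval, hv c hca hcb, hβd]
    field_simp
    ring
  have hzo : ∀ m, m ≠ a → m ≠ c → z m = φ v m + β * φ x m := fun m h1 h2 => by
    rw [hval, hu m h1 h2]
    ring
  have hz0 : ∀ m, 0 ≤ z m := by
    intro m
    by_cases h1 : m = a
    · rw [h1, hza]
    by_cases h2 : m = c
    · rw [h2, hzc]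
    rw [hzo m h1 h2]
    exact add_nonneg (h.nonneg _ _) (mul_nonneg hβ0.le (h.nonneg _ _))
  have hzz : ∀ m, m ≠ b → m ≠ e → z m = 0 := by
    intro m hb he
    by_cases h1 : m = a
    · rw [h1, hza]
    by_cases h2 : m = c
    · rw [h2, hzc]
    rw [hzo m h1 h2, hv m h1 hb, hx m h2 he]
    ring
  obtain ⟨y, hyb, hy⟩ := h.exists_row hz hz0 (i := b) (by
    rw [hzo b hba hcb.symm]
    exact (add_pos_of_pos_of_nonneg hvb' (mul_nonneg hβ0.le (h.nonneg _ _))).ne')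
  by_cases heb : e = b
  · obtain ⟨m, hmb, hym⟩ := hα y b
    exact hym (hy m (hzz m hmb (heb ▸ hmb)))
  have hxb : φ x b = 0 := hx b hcb.symm (Ne.symm heb)
  have hve : φ v e = 0 := hv e hea heb
  have hue : φ u e = 0 := hu e hea hec
  have hT' : ∀ m, m ∉ ({a, b, c, e} : Set ι) → m ≠ a ∧ m ≠ b ∧ m ≠ c ∧ m ≠ e := by
    intro m hm
    simpa [not_or] using hm
  have hmem := face_eq_triple hT (T := {a, b, c, e}) (x := v) (y := u) (w := x) (k := y)
    (fun m hm => hv m (hT' m hm).1 (hT' m hm).2.1)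
    (fun m hm => hu m (hT' m hm).1 (hT' m hm).2.2.1)
    (fun m hm => hx m (hT' m hm).2.2.1 (hT' m hm).2.2.2) (by
      intro p q r he
      have h1 := congrFun he b
      have h2 := congrFun he e
      have h3 := congrFun he a
      simp only [Pi.add_apply, Pi.smul_apply, smul_eq_mul, hub, hxb, hve, hue, hxa,
        Pi.zero_apply, mul_zero, zero_add, add_zero, mul_eq_zero, hvb, hxe, or_false] at h1 h2 h3
      subst h1 h2
      simp only [zero_mul, zero_add, mul_eq_zero, hua, or_false] at h3
      exact ⟨rfl, h3, rfl⟩) (by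
      intro y hy hys
      obtain ⟨t, ht⟩ := h.eq_smul_of_support_subset u
        (z := y - (y b / φ v b) • φ v - (y e / φ x e) • φ x)
        (Submodule.sub_mem _ (Submodule.sub_mem _ hy (Submodule.smul_mem _ _ (mem_span φ v)))
          (Submodule.smul_mem _ _ (mem_span φ x))) (by
          intro m hm
          have hma : m ≠ a := by rintro rfl; exact hua hm
          have hmc : m ≠ c := by rintro rfl; exact huc hm
          simp only [Pi.sub_apply, Pi.smul_apply, smul_eq_mul]
          by_cases hmb : m = b
          · subst hmb
            rw [hxb, div_mul_cancel₀ _ hvb]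
            ring
          by_cases hme : m = e
          · subst hme
            rw [hve, div_mul_cancel₀ _ hxe]
            ring
          rw [hv m hma hmb, hx m hmc hme, hys m (by simp [hma, hmb, hmc, hme])]
          ring)
      exact ⟨_, t, _, by rw [← ht]; abel⟩)
    (fun m hm => hy m (hzz m (hT' m hm).2.1 (hT' m hm).2.2.2))
  have hya : φ y a = 0 := hy a hza
  rcases hmem with rfl | rfl | rfl
  · exact hva hya
  · exact hua hya
  · exact hyb hxb

theorem classification (h : IsSlackMatrix φ) (hT : TriangularFaces φ) {d : ℕ}
    (hd : 3 ≤ d) (hr : Module.finrank ℝ (Submodule.span ℝ (range φ)) = d + 1)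
    (hcard : Fintype.card ι ≤ d + 3) :
    (∃ k i, ∀ j, j ≠ i → φ k j = 0) ∨ Fintype.card κ = d + 1 ∨
      (d = 3 ∧ Fintype.card ι = 6 ∧ Fintype.card κ = 5) := by
  classical
  by_cases hα : ∃ k i, ∀ j, j ≠ i → φ k j = 0
  · exact Or.inl hα
  push Not at hα
  right
  by_cases hs : ∃ v, Nat.card {i // φ v i = 0} = d
  · obtain ⟨v, hv⟩ := hs
    exact h.classification_of_simple hT hd hr hcard hα hv
  push Not at hs
  exfalso
  have hne : Nonempty κ := by
    by_contra hemp
    rw [not_nonempty_iff] at hemp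
    rw [Set.range_eq_empty, Submodule.span_empty, finrank_bot] at hr
    omega
  obtain ⟨v⟩ := hne
  refine h.false_of_forall_support_pair hT v hα fun k a ha => ?_
  obtain ⟨b, hb, hkb⟩ := hα k a
  refine ⟨b, hb, hkb, fun m hma hmb => ?_⟩
  by_contra hkm
  have h1 := card_zeros_add_card_support φ k
  have h2 := h.le_card_zeros k hr
  have h3 := hs k
  have h4 : ({⟨a, ha⟩, ⟨b, hkb⟩, ⟨m, hkm⟩} : Finset {c // φ k c ≠ 0}).card = 3 := by
    rw [Finset.card_insert_of_notMem (by simp [hb.symm, Ne.symm hma]),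
      Finset.card_pair (by simp [Ne.symm hmb])]
  have := Finset.card_le_univ ({⟨a, ha⟩, ⟨b, hkb⟩, ⟨m, hkm⟩} : Finset {c // φ k c ≠ 0})
  rw [← Nat.card_eq_fintype_card] at this
  omega

end IsSlackMatrix

section Polytope

variable {N : ℕ} {P F G : Set (Fin N → ℝ)}

theorem sep_eq_convexHull_of_forall_le {S : Set (Fin N → ℝ)} {l : (Fin N → ℝ) →L[ℝ] ℝ} {m : ℝ}
    (hS : ∀ s ∈ S, l s ≤ m) :
    {x ∈ convexHull ℝ S | l x = m} = convexHull ℝ {s ∈ S | l s = m} := by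
  apply Subset.antisymm
  · have hsub : convexHull ℝ S ⊆ {x | l x ≤ m ∧ (l x = m → x ∈ convexHull ℝ {s ∈ S | l s = m})} := by
      apply convexHull_min
      · exact fun s hs => ⟨hS s hs, fun h => subset_convexHull ℝ _ ⟨hs, h⟩⟩
      · rw [convex_iff_forall_pos]
        rintro x ⟨hx, hx'⟩ y ⟨hy, hy'⟩ a b ha hb hab
        simp only [mem_ofPred_eq, map_add, map_smul, smul_eq_mul]
        have hm : a * m + b * m = m := by rw [← add_mul, hab, one_mul]
        refine ⟨by nlinarith [mul_nonneg ha.le (sub_nonneg.2 hx), mul_nonneg hb.le (sub_nonneg.2 hy)],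
          fun h => ?_⟩
        have h1 : l x = m := by
          by_contra hne
          have : l x < m := lt_of_le_of_ne hx hne
          nlinarith [mul_pos ha (sub_pos.2 this), mul_nonneg hb.le (sub_nonneg.2 hy)]
        have h2 : l y = m := by
          by_contra hne
          have : l y < m := lt_of_le_of_ne hy hne
          nlinarith [mul_pos hb (sub_pos.2 this), mul_nonneg ha.le (sub_nonneg.2 hx)]
        exact convex_convexHull ℝ _ (hx' h1) (hy' h2) ha.le hb.le hab
    rintro x ⟨hx, hxm⟩
    exact (hsub hx).2 hxm
  · refine convexHull_min (fun s hs => ⟨subset_convexHull ℝ _ hs.1, hs.2⟩) ?_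
    exact (convex_convexHull ℝ S).inter (convex_hyperplane l.isLinear m)

theorem le_of_mem_convexHull {S : Set (Fin N → ℝ)} {l : (Fin N → ℝ) →L[ℝ] ℝ} {m : ℝ}
    (hS : ∀ s ∈ S, l s ≤ m) {x : Fin N → ℝ} (hx : x ∈ convexHull ℝ S) : l x ≤ m :=
  convexHull_min (t := {x | l x ≤ m}) hS (convex_halfSpace_le l.isLinear m) hx

theorem IsExposed.of_forall_le {l : (Fin N → ℝ) →L[ℝ] ℝ} {m : ℝ} (hP : ∀ x ∈ P, l x ≤ m) :
    IsExposed ℝ P {x ∈ P | l x = m} := by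
  rintro ⟨x, hx, hxm⟩
  refine ⟨l, Subset.antisymm (fun y hy => ⟨hy.1, fun z hz => (hP z hz).trans hy.2.ge⟩)
    fun y hy => ⟨hy.1, le_antisymm (hP y hy.1) (hxm ▸ hy.2 x hx)⟩⟩

theorem IsExposed.exists_forall_le (h : IsExposed ℝ P F) (hF : F.Nonempty) :
    ∃ (l : (Fin N → ℝ) →L[ℝ] ℝ) (m : ℝ), (∀ x ∈ P, l x ≤ m) ∧ F = {x ∈ P | l x = m} := by
  obtain ⟨l, rfl⟩ := h hF
  obtain ⟨x, hx, hxl⟩ := hF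
  refine ⟨l, l x, hxl, Subset.antisymm (fun y hy => ⟨hy.1, le_antisymm (hxl y hy.1) (hy.2 x hx)⟩)
    fun y hy => ⟨hy.1, fun z hz => (hxl z hz).trans hy.2.ge⟩⟩

theorem IsPolytope.convex (hP : IsPolytope P) : Convex ℝ P := by
  obtain ⟨S, rfl⟩ := hP
  exact convex_convexHull ℝ _

theorem IsPolytope.isCompact (hP : IsPolytope P) : IsCompact P := by
  obtain ⟨S, rfl⟩ := hP
  exact S.finite_toSet.isCompact_convexHull (𝕜 := ℝ)

theorem IsPolytope.finite_extremePoints (hP : IsPolytope P) : (P.extremePoints ℝ).Finite := by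
  obtain ⟨S, rfl⟩ := hP
  exact S.finite_toSet.subset extremePoints_convexHull_subset

theorem IsPolytope.convexHull_extremePoints (hP : IsPolytope P) :
    convexHull ℝ (P.extremePoints ℝ) = P := by
  have := closure_convexHull_extremePoints hP.isCompact hP.convex
  rwa [(hP.finite_extremePoints.isClosed_convexHull (𝕜 := ℝ)).closure_eq] at this

theorem vertexSet_subset_extremePoints : vertexSet P ⊆ P.extremePoints ℝ := by
  intro v hv
  have h : IsExposed ℝ P {v} := hv
  exact (isExtreme_singleton (𝕜 := ℝ)).1 (IsExposed.isExtreme h)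

theorem IsPolytope.vertexSet_eq (hP : IsPolytope P) : vertexSet P = P.extremePoints ℝ := by
  refine Subset.antisymm vertexSet_subset_extremePoints fun p hp => ?_
  have hconv := (hP.convex.mem_extremePoints_iff_convex_sdiff.1 hp).2
  have hnot : p ∉ convexHull ℝ (P.extremePoints ℝ \ {p}) := fun h =>
    (convexHull_min (sdiff_subset_sdiff_left extremePoints_subset) hconv h).2 rfl
  obtain ⟨l, u, hl, hu⟩ := geometric_hahn_banach_closed_point (convex_convexHull ℝ _)
    ((hP.finite_extremePoints.subset sdiff_subset).isClosed_convexHull (𝕜 := ℝ)) hnot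
  have hlt : ∀ s ∈ P.extremePoints ℝ, s ≠ p → l s < l p := fun s hs hsp =>
    (hl s (subset_convexHull ℝ _ ⟨hs, hsp⟩)).trans hu
  have hle : ∀ s ∈ P.extremePoints ℝ, l s ≤ l p := fun s hs => by
    rcases eq_or_ne s p with rfl | h
    · exact le_rfl
    · exact (hlt s hs h).le
  have key := sep_eq_convexHull_of_forall_le hle
  rw [hP.convexHull_extremePoints] at key
  have h1 : {s ∈ P.extremePoints ℝ | l s = l p} = {p} := by
    ext s
    refine ⟨fun hs => ?_, fun hs => ?_⟩
    · by_contra h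
      exact (hlt s hs.1 h).ne hs.2
    · rw [mem_singleton_iff] at hs
      subst hs
      exact ⟨hp, rfl⟩
  rw [h1, convexHull_singleton] at key
  change IsExposed ℝ P {p}
  rw [← key]
  refine IsExposed.of_forall_le fun x hx => ?_
  rw [← hP.convexHull_extremePoints] at hx
  exact le_of_mem_convexHull hle hx

theorem IsPolytope.finite_vertexSet (hP : IsPolytope P) : (vertexSet P).Finite :=
  hP.vertexSet_eq ▸ hP.finite_extremePoints

theorem IsPolytope.convexHull_vertexSet (hP : IsPolytope P) : convexHull ℝ (vertexSet P) = P :=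
  hP.vertexSet_eq ▸ hP.convexHull_extremePoints

theorem vertexSet_subset : vertexSet P ⊆ P :=
  vertexSet_subset_extremePoints.trans extremePoints_subset

theorem vertexSet_convexHull_subset {S : Set (Fin N → ℝ)} : vertexSet (convexHull ℝ S) ⊆ S :=
  vertexSet_subset_extremePoints.trans extremePoints_convexHull_subset

theorem isPolytope_convexHull {S : Set (Fin N → ℝ)} (hS : S.Finite) :
    IsPolytope (convexHull ℝ S) :=
  ⟨hS.toFinset, by simp⟩

theorem IsPolytope.exposed_eq (hP : IsPolytope P) (hF : IsExposed ℝ P F) :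
    F = convexHull ℝ (vertexSet P ∩ F) := by
  rcases F.eq_empty_or_nonempty with rfl | hne
  · simp
  obtain ⟨l, m, hl, rfl⟩ := hF.exists_forall_le hne
  have := sep_eq_convexHull_of_forall_le (S := vertexSet P) (l := l) (m := m)
    fun s hs => hl s (vertexSet_subset hs)
  rw [hP.convexHull_vertexSet] at this
  rw [this]
  congr 1
  ext s
  constructor
  · rintro ⟨h1, h2⟩
    exact ⟨h1, subset_convexHull ℝ _ ⟨h1, h2⟩⟩
  · rintro ⟨h1, h2⟩
    rw [← this] at h2
    exact ⟨h1, h2.2⟩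

theorem IsPolytope.of_isExposed (hP : IsPolytope P) (hF : IsExposed ℝ P F) : IsPolytope F := by
  rw [hP.exposed_eq hF]
  exact isPolytope_convexHull (hP.finite_vertexSet.subset inter_subset_left)

theorem IsPolytope.vertexSet_of_isExposed (hP : IsPolytope P) (hF : IsExposed ℝ P F) :
    vertexSet F = vertexSet P ∩ F := by
  apply Subset.antisymm
  · conv_lhs => rw [hP.exposed_eq hF]
    exact vertexSet_convexHull_subset
  · rw [(hP.of_isExposed hF).vertexSet_eq, hP.vertexSet_eq]
    exact fun x hx => inter_extremePoints_subset_extremePoints_of_subset hF.subset ⟨hx.2, hx.1⟩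

theorem IsPolytope.finite_facetSet (hP : IsPolytope P) : (facetSet P).Finite := by
  refine (hP.finite_vertexSet.finite_subsets.image (convexHull ℝ)).subset fun F hF => ?_
  exact ⟨vertexSet P ∩ F, inter_subset_left, (hP.exposed_eq hF.1).symm⟩

theorem pdim_eq_finrank_vectorSpan (P : Set (Fin N → ℝ)) :
    pdim P = Module.finrank ℝ (vectorSpan ℝ P) := by
  rw [pdim, direction_affineSpan]

theorem vectorSpan_eq_of_pdim_eq (hFP : F ⊆ P) (h : pdim F = pdim P) :
    vectorSpan ℝ F = vectorSpan ℝ P := by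
  rw [pdim_eq_finrank_vectorSpan, pdim_eq_finrank_vectorSpan] at h
  exact Submodule.eq_of_le_of_finrank_eq (vectorSpan_mono ℝ hFP) h

theorem map_eq_of_mem_affineSpan {l : (Fin N → ℝ) →L[ℝ] ℝ} {m : ℝ} (hF : ∀ y ∈ F, l y = m)
    {x : Fin N → ℝ} (hx : x ∈ affineSpan ℝ F) : l x = m := by
  have hne : F.Nonempty := (affineSpan_nonempty ℝ).1 ⟨x, hx⟩
  obtain ⟨p, hp⟩ := hne
  have h1 : vectorSpan ℝ F ≤ LinearMap.ker (l : (Fin N → ℝ) →ₗ[ℝ] ℝ) := by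
    rw [vectorSpan_eq_span_vsub_set_right ℝ hp, Submodule.span_le]
    rintro _ ⟨y, hy, rfl⟩
    simp [hF y hy, hF p hp]
  have h2 := h1 (vsub_mem_vectorSpan_of_mem_affineSpan_of_mem_affineSpan hx
    (subset_affineSpan ℝ F hp))
  simp only [vsub_eq_sub, LinearMap.mem_ker, ContinuousLinearMap.coe_coe, map_sub, hF p hp] at h2
  linarith

theorem pdim_lt_of_mem_affineSpan {l : (Fin N → ℝ) →L[ℝ] ℝ} {m : ℝ} (hFP : F ⊆ P)
    (hF : ∀ y ∈ F, l y = m) (hne : F.Nonempty) {x : Fin N → ℝ} (hx : x ∈ affineSpan ℝ P)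
    (hlx : l x ≠ m) : pdim F < pdim P := by
  obtain ⟨p, hp⟩ := hne
  refine lt_of_le_of_ne ?_ fun h => hlx ?_
  · rw [pdim_eq_finrank_vectorSpan, pdim_eq_finrank_vectorSpan]
    exact Submodule.finrank_mono (vectorSpan_mono ℝ hFP)
  · apply map_eq_of_mem_affineSpan hF
    have h2 := vsub_mem_vectorSpan_of_mem_affineSpan_of_mem_affineSpan hx
      (subset_affineSpan ℝ P (hFP hp))
    rw [← vectorSpan_eq_of_pdim_eq hFP h] at h2
    simpa using vadd_mem_affineSpan_of_mem_affineSpan_of_mem_vectorSpan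
      (subset_affineSpan ℝ F hp) h2

theorem IsPolytope.exists_larger_face (hP : IsPolytope P) {l : (Fin N → ℝ) →L[ℝ] ℝ} {m : ℝ}
    (hl : ∀ y ∈ P, l y ≤ m) {p x : Fin N → ℝ} (hp : p ∈ P) (hpm : l p = m)
    (hlx : m < l x)
    (hlt : pdim {y ∈ P | l y = m} + 1 < pdim P) :
    ∃ (l' : (Fin N → ℝ) →L[ℝ] ℝ) (m' : ℝ), (∀ y ∈ P, l' y ≤ m') ∧ l' p = m' ∧ m' < l' x ∧
      pdim {y ∈ P | l y = m} < pdim {y ∈ P | l' y = m'} := by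
  set F := {y ∈ P | l y = m} with hF
  have hpF : p ∈ F := ⟨hp, hpm⟩
  set W := vectorSpan ℝ F ⊔ Submodule.span ℝ {x - p} with hW
  have hWP : ¬ vectorSpan ℝ P ≤ W := by
    intro h
    have h1 := Submodule.finrank_mono h
    have h2 : Module.finrank ℝ W ≤ Module.finrank ℝ (vectorSpan ℝ F) + 1 :=
      (Submodule.finrank_add_le_finrank_add_finrank _ _).trans
        (add_le_add_right ((finrank_span_le_card {x - p}).trans (by simp)) _)
    rw [pdim_eq_finrank_vectorSpan, pdim_eq_finrank_vectorSpan] at hlt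
    omega
  obtain ⟨y, hyP, hyW⟩ := SetLike.not_le_iff_exists.1 hWP
  obtain ⟨f, hfy, hWf⟩ := Submodule.exists_le_ker_of_notMem hyW
  have hs : ∃ s ∈ P, f (s - p) ≠ 0 := by
    by_contra! h
    apply hfy
    have : vectorSpan ℝ P ≤ LinearMap.ker f := by
      rw [vectorSpan_eq_span_vsub_set_right ℝ hp, Submodule.span_le]
      rintro _ ⟨s, hs, rfl⟩
      exact h s hs
    exact this hyP
  obtain ⟨g, hWg, s, hs, hgs⟩ : ∃ g : (Fin N → ℝ) →L[ℝ] ℝ, (∀ w ∈ W, g w = 0) ∧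
      ∃ s ∈ P, g p < g s := by
    obtain ⟨s, hs, hfs⟩ := hs
    rcases hfs.lt_or_gt with h | h
    · refine ⟨LinearMap.toContinuousLinearMap (-f), fun w hw => ?_, s, hs, ?_⟩
      · simpa using hWf hw
      · simpa [map_sub] using h
    · refine ⟨LinearMap.toContinuousLinearMap f, fun w hw => ?_, s, hs, ?_⟩
      · simpa using hWf hw
      · simpa [map_sub] using h
  have hgF : ∀ y ∈ F, g y = g p := fun y hy => by
    have := hWg _ (Submodule.mem_sup_left (vsub_mem_vectorSpan ℝ hy hpF))
    rwa [vsub_eq_sub, map_sub, sub_eq_zero] at this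
  have hgx : g x = g p := by
    have := hWg _ (Submodule.mem_sup_right (Submodule.mem_span_singleton_self (x - p)))
    rwa [map_sub, sub_eq_zero] at this
  set V := {v ∈ vertexSet P | g p < g v} with hV
  have hVf : V.Finite := hP.finite_vertexSet.subset fun v hv => hv.1
  have hVne : V.Nonempty := by
    by_contra h
    rw [not_nonempty_iff_eq_empty] at h
    refine hgs.not_ge (le_of_mem_convexHull (S := vertexSet P) (fun v hv => ?_)
      (hP.convexHull_vertexSet.symm ▸ hs))
    by_contra! h'
    exact (h ▸ (⟨hv, h'⟩ : v ∈ V) : v ∈ (∅ : Set (Fin N → ℝ)))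
  obtain ⟨v, hv, hmin⟩ := exists_min_image V (fun v => (m - l v) / (g v - g p)) hVf hVne
  set t := (m - l v) / (g v - g p) with ht
  have hvP := vertexSet_subset hv.1
  have ht0 : 0 ≤ t := div_nonneg (sub_nonneg.2 (hl v hvP)) (sub_nonneg.2 hv.2.le)
  have htv : t * (g v - g p) = m - l v := div_mul_cancel₀ _ (sub_pos.2 hv.2).ne'
  have hle : ∀ y ∈ P, (l + t • g) y ≤ m + t * g p := fun y hy => by
    refine le_of_mem_convexHull (S := vertexSet P) (fun u hu => ?_)
      (hP.convexHull_vertexSet.symm ▸ hy)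
    simp only [add_apply, smul_apply, smul_eq_mul]
    rcases le_or_gt (g u) (g p) with h | h
    · nlinarith [hl u (vertexSet_subset hu)]
    · have := hmin u ⟨hu, h⟩
      rw [le_div_iff₀ (sub_pos.2 h)] at this
      linarith
  refine ⟨l + t • g, m + t * g p, hle, by simp [hpm], by simp [hgx, hlx], ?_⟩
  apply pdim_lt_of_mem_affineSpan (l := g) (m := g p) (x := v) _ hgF ⟨p, hpF⟩
  · apply subset_affineSpan
    refine ⟨hvP, ?_⟩
    simp only [add_apply, smul_apply, smul_eq_mul]
    linarith
  · exact hv.2.ne'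
  · intro y hy
    refine ⟨hy.1, ?_⟩
    simp [hy.2, hgF y hy]

theorem IsPolytope.exists_isFacetOf_lt (hP : IsPolytope P) {x : Fin N → ℝ}
    (hx : x ∈ affineSpan ℝ P) (hxP : x ∉ P) :
    ∃ (l : (Fin N → ℝ) →L[ℝ] ℝ) (m : ℝ), (∀ y ∈ P, l y ≤ m) ∧ IsFacetOf P {y ∈ P | l y = m} ∧
      m < l x := by
  have main : ∀ (n : ℕ) (l : (Fin N → ℝ) →L[ℝ] ℝ) (m : ℝ) (p : Fin N → ℝ), (∀ y ∈ P, l y ≤ m) →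
      p ∈ P → l p = m → m < l x → pdim P ≤ pdim {y ∈ P | l y = m} + n →
      ∃ (l : (Fin N → ℝ) →L[ℝ] ℝ) (m : ℝ), (∀ y ∈ P, l y ≤ m) ∧
        IsFacetOf P {y ∈ P | l y = m} ∧ m < l x := by
    intro n
    induction n with
    | zero =>
      intro l m p hl hp hpm hlx hn
      have := pdim_lt_of_mem_affineSpan (F := {y ∈ P | l y = m}) (l := l) (m := m)
        (sep_subset _ _) (fun y hy => hy.2) ⟨p, hp, hpm⟩ hx hlx.ne'
      omega
    | succ n ih =>
      intro l m p hl hp hpm hlx hn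
      have hlt := pdim_lt_of_mem_affineSpan (F := {y ∈ P | l y = m}) (l := l) (m := m)
        (sep_subset _ _) (fun y hy => hy.2) ⟨p, hp, hpm⟩ hx hlx.ne'
      rcases eq_or_lt_of_le (Nat.succ_le_of_lt hlt) with h | h
      · exact ⟨l, m, hl, ⟨IsExposed.of_forall_le hl, ⟨p, hp, hpm⟩, h⟩, hlx⟩
      · obtain ⟨l', m', hl', hp', hx', hd'⟩ := hP.exists_larger_face hl hp hpm hlx h
        exact ih l' m' p hl' hp hp' hx' (by omega)
  obtain ⟨l, u, hl, hu⟩ := geometric_hahn_banach_closed_point hP.convex hP.isCompact.isClosed hxP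
  have hne : P.Nonempty := (affineSpan_nonempty ℝ).1 ⟨x, hx⟩
  obtain ⟨p, hp, hmax⟩ := hP.isCompact.exists_isMaxOn hne l.continuous.continuousOn
  exact main (pdim P) l (l p) p (fun y hy => hmax hy) hp rfl ((hl p hp).trans hu) (by omega)

/-- A facet is cut out of the affine hull by any functional exposing it. -/
theorem IsFacetOf.pos_of_pos {l l' : (Fin N → ℝ) →L[ℝ] ℝ} {m m' : ℝ} {x : Fin N → ℝ}
    (hl : ∀ y ∈ P, l y ≤ m) (hl' : ∀ y ∈ P, l' y ≤ m') (hF : IsFacetOf P F)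
    (h : F = {y ∈ P | l y = m}) (h' : F = {y ∈ P | l' y = m'}) (hx : x ∈ affineSpan ℝ P)
    (hlx : m < l x) : m' < l' x := by
  obtain ⟨p, hp⟩ := hF.2.1
  have hFP : F ⊆ P := hF.1.subset
  have hFl : ∀ y ∈ F, l y = m := fun y hy => by rw [h] at hy; exact hy.2
  have hFl' : ∀ y ∈ F, l' y = m' := fun y hy => by rw [h'] at hy; exact hy.2
  obtain ⟨q, hqP, hqF⟩ : ∃ q ∈ P, q ∉ F := by
    by_contra! hcon
    have h1 : F = P := Subset.antisymm hFP hcon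
    have h2 := hF.2.2
    rw [h1] at h2
    omega
  have hql : l q < m := lt_of_le_of_ne (hl q hqP) fun hc => hqF (h ▸ ⟨hqP, hc⟩)
  have hql' : l' q < m' := lt_of_le_of_ne (hl' q hqP) fun hc => hqF (h' ▸ ⟨hqP, hc⟩)
  have hker : ∀ (k : (Fin N → ℝ) →L[ℝ] ℝ) (c : ℝ), (∀ y ∈ F, k y = c) →
      ∀ w ∈ vectorSpan ℝ F, k w = 0 := by
    intro k c hk w hw
    have h1 : vectorSpan ℝ F ≤ LinearMap.ker (k : (Fin N → ℝ) →ₗ[ℝ] ℝ) := by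
      rw [vectorSpan_eq_span_vsub_set_right ℝ hp, Submodule.span_le]
      rintro _ ⟨y, hy, rfl⟩
      simp [hk y hy, hk p hp]
    exact h1 hw
  have hnot : q - p ∉ vectorSpan ℝ F := fun hc => by
    have := hker l m hFl _ hc
    rw [map_sub, hFl p hp] at this
    linarith
  have hsup : vectorSpan ℝ F ⊔ Submodule.span ℝ {q - p} = vectorSpan ℝ P := by
    apply Submodule.eq_of_le_of_finrank_eq
    · refine sup_le (vectorSpan_mono ℝ hFP) ?_
      rw [Submodule.span_singleton_le_iff_mem]
      exact vsub_mem_vectorSpan ℝ hqP (hFP hp)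
    · rw [Submodule.finrank_sup_span_singleton hnot, ← pdim_eq_finrank_vectorSpan,
        ← pdim_eq_finrank_vectorSpan, hF.2.2]
  have hxp := vsub_mem_vectorSpan_of_mem_affineSpan_of_mem_affineSpan hx
    (subset_affineSpan ℝ P (hFP hp))
  rw [← hsup, Submodule.mem_sup] at hxp
  obtain ⟨w, hw, z, hz, hwz⟩ := hxp
  obtain ⟨a, rfl⟩ := Submodule.mem_span_singleton.1 hz
  have e1 := congrArg l hwz
  have e2 := congrArg l' hwz
  simp only [vsub_eq_sub, map_add, map_smul, map_sub, smul_eq_mul, hker l m hFl w hw,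
    hker l' m' hFl' w hw, hFl p hp, hFl' p hp] at e1 e2
  have ha : a < 0 := by
    by_contra! ha
    nlinarith
  nlinarith [mul_pos_of_neg_of_neg ha (sub_neg.2 hql')]

/-- A system of inequalities exposing the facets of `P` and defining `P` in its affine hull. -/
structure IsFacetSystem (P : Set (Fin N → ℝ)) (l : facetSet P → (Fin N → ℝ) →L[ℝ] ℝ)
    (c : facetSet P → ℝ) : Prop where
  le : ∀ F, ∀ y ∈ P, l F y ≤ c F
  facet_eq : ∀ F : facetSet P, (F : Set (Fin N → ℝ)) = {y ∈ P | l F y = c F}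
  mem : ∀ x ∈ affineSpan ℝ P, (∀ F, l F x ≤ c F) → x ∈ P

theorem IsPolytope.exists_isFacetSystem (hP : IsPolytope P) : ∃ l c, IsFacetSystem P l c := by
  have h (F : facetSet P) := (show IsFacetOf P F from F.2).1.exists_forall_le
    (show IsFacetOf P F from F.2).2.1
  choose l c hle heq using h
  refine ⟨l, c, hle, heq, fun x hx hlx => ?_⟩
  by_contra hxP
  obtain ⟨l', m', hl', hF, hlt⟩ := hP.exists_isFacetOf_lt hx hxP
  exact (hlx ⟨_, hF⟩).not_gt
    (IsFacetOf.pos_of_pos hl' (hle ⟨_, hF⟩) hF rfl (heq ⟨_, hF⟩) hx hlt)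

/-- The slack of a point with respect to a system of inequalities. -/
def slack {ι : Type*} (l : ι → (Fin N → ℝ) →L[ℝ] ℝ) (c : ι → ℝ) (x : Fin N → ℝ) : ι → ℝ :=
  fun F => c F - l F x

theorem facet_eq_of_subset (hF : IsFacetOf P F) (hG : IsFacetOf P G) (h : G ⊆ F) : G = F := by
  refine Subset.antisymm h fun x hx => ?_
  obtain ⟨l, m, hl, hGe⟩ := hG.1.exists_forall_le hG.2.1
  have hspan := vectorSpan_eq_of_pdim_eq h (by have := hF.2.2; have := hG.2.2; omega)
  obtain ⟨p, hp⟩ := hG.2.1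
  rw [hGe]
  refine ⟨hF.1.subset hx, map_eq_of_mem_affineSpan (F := G) (fun y hy => ?_) ?_⟩
  · rw [hGe] at hy
    exact hy.2
  · have h2 := vsub_mem_vectorSpan ℝ hx (h hp)
    rw [← hspan] at h2
    simpa using vadd_mem_affineSpan_of_mem_affineSpan_of_mem_vectorSpan
      (subset_affineSpan ℝ G hp) h2

namespace IsFacetSystem

variable {l : facetSet P → (Fin N → ℝ) →L[ℝ] ℝ} {c : facetSet P → ℝ}

theorem slack_nonneg (h : IsFacetSystem P l c) {x : Fin N → ℝ} (hx : x ∈ P) (F) :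
    0 ≤ slack l c x F :=
  sub_nonneg.2 (h.le F x hx)

theorem slack_eq_zero (h : IsFacetSystem P l c) {x : Fin N → ℝ} (hx : x ∈ P) (F : facetSet P) :
    slack l c x F = 0 ↔ x ∈ (F : Set (Fin N → ℝ)) := by
  rw [h.facet_eq F, slack, sub_eq_zero]
  exact ⟨fun e => ⟨hx, e.symm⟩, fun e => e.2.symm⟩

theorem eq_zero_of_forall_le (h : IsFacetSystem P l c) (hP : IsPolytope P) (hne : P.Nonempty)
    {y : Fin N → ℝ} (hy : y ∈ vectorSpan ℝ P) (hly : ∀ F, l F y ≤ 0) : y = 0 := by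
  by_contra hy0
  obtain ⟨p, hp⟩ := hne
  obtain ⟨R, hR⟩ := hP.isCompact.isBounded.exists_norm_le
  have hypos : 0 < ‖y‖ := norm_pos_iff.2 hy0
  have hR0 : 0 ≤ R := (norm_nonneg p).trans (hR p hp)
  set t := (R + ‖p‖ + 1) / ‖y‖ with ht
  have ht0 : 0 ≤ t := by positivity
  have hmem : t • y + p ∈ P := by
    refine h.mem _ (vadd_mem_affineSpan_of_mem_affineSpan_of_mem_vectorSpan
      (subset_affineSpan ℝ P hp) (Submodule.smul_mem _ t hy)) fun F => ?_
    have := h.le F p hp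
    simp only [map_add, map_smul, smul_eq_mul]
    nlinarith [hly F]
  have h1 := hR _ hmem
  have h2 : ‖t • y‖ = R + ‖p‖ + 1 := by
    rw [norm_smul, Real.norm_of_nonneg ht0, ht, div_mul_cancel₀ _ hypos.ne']
  have h3 := norm_sub_le (t • y + p) p
  rw [add_sub_cancel_right] at h3
  linarith

theorem exists_slack_pos (h : IsFacetSystem P l c) (hP : IsPolytope P) (hnt : P.Nontrivial)
    {x : Fin N → ℝ} (hx : x ∈ affineSpan ℝ P) : ∃ F, 0 < slack l c x F := by
  by_contra! hcon
  obtain ⟨p, hp, q, hq, hpq⟩ := hnt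
  have key : ∀ p ∈ P, p = x := fun p hp => by
    have := h.eq_zero_of_forall_le hP ⟨p, hp⟩ (y := p - x)
      (vsub_mem_vectorSpan_of_mem_affineSpan_of_mem_affineSpan (subset_affineSpan ℝ P hp) hx)
      fun F => by
        have h1 := h.le F p hp
        have h2 := hcon F
        rw [slack] at h2
        rw [map_sub]
        linarith
    rwa [sub_eq_zero] at this
  exact hpq ((key p hp).trans (key q hq).symm)

theorem isSlackMatrix [Fintype (vertexSet P)] [Fintype (facetSet P)] (h : IsFacetSystem P l c)
    (hP : IsPolytope P) (hnt : P.Nontrivial) :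
    IsSlackMatrix fun v : vertexSet P => slack l c v where
  nonneg v F := h.slack_nonneg (vertexSet_subset v.2) F
  ne_zero v h0 := by
    obtain ⟨F, hF⟩ := h.exists_slack_pos hP hnt (subset_affineSpan ℝ P (vertexSet_subset v.2))
    exact hF.ne' (congrFun h0 F)
  cone z hz hz0 := by
    obtain ⟨a, rfl⟩ := (Submodule.mem_span_range_iff_exists_fun ℝ).1 hz
    set s := ∑ v : vertexSet P, a v • (v : Fin N → ℝ) with hs
    set k := ∑ v : vertexSet P, a v with hk
    have hval : ∀ (b : vertexSet P → ℝ) (F : facetSet P),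
        (∑ v : vertexSet P, b v • slack l c v) F =
          (∑ v : vertexSet P, b v) * c F - l F (∑ v : vertexSet P, b v • (v : Fin N → ℝ)) := by
      intro b F
      simp [slack, mul_sub, Finset.sum_sub_distrib, Finset.sum_mul]
    have hz0' : ∀ F, l F s ≤ k * c F := fun F => by
      have := hz0 F
      rw [hval] at this
      linarith
    obtain ⟨p, hp⟩ := hnt.nonempty
    have hsk : s - k • p ∈ vectorSpan ℝ P := by
      have : s - k • p = ∑ v : vertexSet P, a v • ((v : Fin N → ℝ) - p) := by
        simp [hs, hk, smul_sub, Finset.sum_smul]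
      rw [this]
      exact Submodule.sum_mem _ fun v _ => Submodule.smul_mem _ _
        (vsub_mem_vectorSpan ℝ (vertexSet_subset v.2) hp)
    have haff : k ≠ 0 → k⁻¹ • s ∈ affineSpan ℝ P := fun hk0 => by
      have := vadd_mem_affineSpan_of_mem_affineSpan_of_mem_vectorSpan
        (subset_affineSpan ℝ P hp) (Submodule.smul_mem _ k⁻¹ hsk)
      simpa [smul_sub, smul_smul, hk0] using this
    rcases lt_trichotomy k 0 with hk0 | hk0 | hk0
    · obtain ⟨F, hF⟩ := h.exists_slack_pos hP hnt (haff hk0.ne)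
      have := hz0' F
      simp only [slack, map_smul, smul_eq_mul] at hF
      have h1 : k * (c F - k⁻¹ * l F s) < 0 := mul_neg_of_neg_of_pos hk0 hF
      rw [mul_sub, mul_inv_cancel_left₀ hk0.ne] at h1
      linarith
    · have hs0 : s = 0 := h.eq_zero_of_forall_le hP ⟨p, hp⟩ (by simpa [hk0] using hsk)
        fun F => by simpa [hk0] using hz0' F
      refine ⟨0, fun _ => le_rfl, ?_⟩
      ext F
      rw [hval, hval, ← hs, ← hk, hk0, hs0]
      simp
    · have hxP : k⁻¹ • s ∈ P := h.mem _ (haff hk0.ne') fun F => by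
        rw [map_smul, smul_eq_mul, inv_mul_le_iff₀ hk0]
        exact hz0' F
      rw [← hP.convexHull_vertexSet, hP.finite_vertexSet.convexHull_eq] at hxP
      obtain ⟨w, hw0, hw1, hwx⟩ := hxP
      have e1 : ∑ v : vertexSet P, w v = 1 := by
        rw [← hw1]
        exact (Finset.sum_subtype _ (fun x => hP.finite_vertexSet.mem_toFinset) w).symm
      have e2 : ∑ v : vertexSet P, w v • (v : Fin N → ℝ) = k⁻¹ • s := by
        rw [← hwx, Finset.centerMass_eq_of_sum_1 _ _ hw1]
        exact (Finset.sum_subtype _ (fun x => hP.finite_vertexSet.mem_toFinset)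
          fun v => w v • id v).symm
      refine ⟨fun v => k * w v, fun v => mul_nonneg hk0.le (hw0 v v.2), ?_⟩
      ext F
      rw [hval, hval, ← Finset.mul_sum, e1]
      simp_rw [mul_smul]
      rw [← Finset.smul_sum, e2, smul_inv_smul₀ hk0.ne', mul_one]
  minimal u v huv := by
    obtain ⟨ε, hε, hle⟩ := exists_pos_forall_nonneg_add_mul (slack l c v)
      (fun F => slack l c v F - slack l c u F) (h.slack_nonneg (vertexSet_subset v.2))
      fun F hF => by rw [hF, huv F hF, sub_zero]
    have hw : ε • ((v : Fin N → ℝ) - u) + v ∈ P := by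
      refine h.mem _ (vadd_mem_affineSpan_of_mem_affineSpan_of_mem_vectorSpan
        (subset_affineSpan ℝ P (vertexSet_subset v.2)) (Submodule.smul_mem _ ε
          (vsub_mem_vectorSpan ℝ (vertexSet_subset v.2) (vertexSet_subset u.2)))) fun F => ?_
      have := hle F
      simp only [slack] at this
      simp only [map_add, map_smul, map_sub, smul_eq_mul]
      linarith
    have hv : IsExposed ℝ P {(v : Fin N → ℝ)} := v.2
    obtain ⟨f, m, hf, hfe⟩ := hv.exists_forall_le (singleton_nonempty _)
    have h1 : f v = m := (hfe ▸ mem_singleton (v : Fin N → ℝ)).2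
    have h2 := hf _ hw
    simp only [map_add, map_smul, map_sub, smul_eq_mul] at h2
    have h3 := hf _ (vertexSet_subset u.2)
    have h4 : (u : Fin N → ℝ) ∈ ({(v : Fin N → ℝ)} : Set (Fin N → ℝ)) := by
      rw [hfe]
      refine ⟨vertexSet_subset u.2, le_antisymm h3 ?_⟩
      have : ε * (f v - f u) ≤ 0 := by linarith
      have := nonpos_of_mul_nonpos_right this hε
      linarith
    exact Subtype.ext h4
  irredundant F G hFG := by
    by_contra! hcon
    refine hFG (Subtype.ext (facet_eq_of_subset F.2 G.2 ?_).symm)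
    have hG : IsFacetOf P G := G.2
    have hF : IsFacetOf P F := F.2
    rw [hP.exposed_eq hG.1]
    refine convexHull_min (fun v hv => ?_) (hF.1.convex hP.convex)
    rw [← h.slack_eq_zero (vertexSet_subset hv.1)]
    by_contra hne
    exact hcon ⟨v, hv.1⟩ hne ((h.slack_eq_zero (vertexSet_subset hv.1) G).2 hv.2)

theorem finrank_span_slack [Fintype (facetSet P)] (h : IsFacetSystem P l c) (hP : IsPolytope P)
    (hnt : P.Nontrivial) {X : Set (Fin N → ℝ)} (hX : X.Nonempty) (hXP : X ⊆ P) :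
    Module.finrank ℝ (Submodule.span ℝ (slack l c '' X)) = pdim X + 1 := by
  obtain ⟨p, hp⟩ := hX
  have hspan := vectorSpan_mono ℝ hXP
  set L : (Fin N → ℝ) →ₗ[ℝ] (facetSet P → ℝ) :=
    LinearMap.pi fun F => (l F : (Fin N → ℝ) →ₗ[ℝ] ℝ) with hL
  have hLa : ∀ x F, L x F = l F x := fun x F => rfl
  have hsl : ∀ x, slack l c x = slack l c p - L (x - p) := fun x => by
    ext F
    simp [slack, hLa]
  have heq : Submodule.span ℝ (slack l c '' X) =
      (vectorSpan ℝ X).map L ⊔ Submodule.span ℝ {slack l c p} := by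
    apply le_antisymm
    · rw [Submodule.span_le]
      rintro _ ⟨x, hx, rfl⟩
      rw [hsl x]
      exact Submodule.sub_mem _ (Submodule.mem_sup_right (Submodule.mem_span_singleton_self _))
        (Submodule.mem_sup_left (Submodule.mem_map_of_mem (vsub_mem_vectorSpan ℝ hx hp)))
    · refine sup_le ?_ ?_
      · rw [vectorSpan_eq_span_vsub_set_right ℝ hp, Submodule.map_span_le]
        rintro _ ⟨x, hx, rfl⟩
        have : L (x -ᵥ p) = slack l c p - slack l c x := by
          rw [hsl x, vsub_eq_sub]
          abel
        rw [this]
        exact Submodule.sub_mem _ (Submodule.subset_span (mem_image_of_mem _ hp))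
          (Submodule.subset_span (mem_image_of_mem _ hx))
      · rw [Submodule.span_singleton_le_iff_mem]
        exact Submodule.subset_span (mem_image_of_mem _ hp)
  have hnot : slack l c p ∉ (vectorSpan ℝ X).map L := by
    rintro ⟨w, hw, hwp⟩
    obtain ⟨F, hF⟩ := h.exists_slack_pos hP hnt
      (vadd_mem_affineSpan_of_mem_affineSpan_of_mem_vectorSpan
        (subset_affineSpan ℝ P (hXP hp)) (hspan hw))
    rw [hsl, vadd_eq_add, add_sub_cancel_right, hwp, sub_self] at hF
    exact lt_irrefl _ hF
  have hinj : Function.Injective (L.domRestrict (vectorSpan ℝ X)) := by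
    rw [← LinearMap.ker_eq_bot, LinearMap.ker_eq_bot']
    rintro ⟨w, hw⟩ hw0
    refine Subtype.ext (h.eq_zero_of_forall_le hP hnt.nonempty (hspan hw) fun F => ?_)
    exact (congrFun hw0 F).le
  rw [heq, Submodule.finrank_sup_span_singleton hnot, pdim_eq_finrank_vectorSpan,
    ← LinearMap.range_domRestrict, LinearMap.finrank_range_of_inj hinj]

end IsFacetSystem

theorem pdim_convexHull (X : Set (Fin N → ℝ)) : pdim (convexHull ℝ X) = pdim X := by
  rw [pdim, affineSpan_convexHull, pdim]

theorem IsPolytope.pdim_vertexSet (hP : IsPolytope P) : pdim (vertexSet P) = pdim P := by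
  rw [← pdim_convexHull, hP.convexHull_vertexSet]

theorem IsPolytope.nonempty_vertexSet (hP : IsPolytope P) (hne : P.Nonempty) :
    (vertexSet P).Nonempty := by
  rw [← convexHull_nonempty_iff (𝕜 := ℝ), hP.convexHull_vertexSet]
  exact hne

namespace IsFacetSystem

variable {l : facetSet P → (Fin N → ℝ) →L[ℝ] ℝ} {c : facetSet P → ℝ}

theorem finrank_span_range_slack [Fintype (facetSet P)] (h : IsFacetSystem P l c)
    (hP : IsPolytope P) (hnt : P.Nontrivial) :
    Module.finrank ℝ (Submodule.span ℝ (range fun v : vertexSet P => slack l c v)) =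
      pdim P + 1 := by
  have := h.finrank_span_slack hP hnt (hP.nonempty_vertexSet hnt.nonempty) vertexSet_subset
  rwa [hP.pdim_vertexSet, image_eq_range] at this

theorem triangularFaces [Fintype (facetSet P)] (h : IsFacetSystem P l c)
    (hP : IsPolytope P) (hnt : P.Nontrivial) (hs : TwoSimplicial P) :
    TriangularFaces fun v : vertexSet P => slack l c v := by
  classical
  intro T hT
  set X := {v : vertexSet P | ∀ F, F ∉ T → slack l c v F = 0} with hX
  set A := {x ∈ P | ∀ F, F ∉ T → slack l c x F = 0} with hA
  have hAexp : IsExposed ℝ P A := by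
    have hsum : ∀ x, (∑ F ∈ Finset.univ.filter (· ∉ T), l F) x =
        ∑ F ∈ Finset.univ.filter (· ∉ T), l F x := fun x => by simp
    have : A = {x ∈ P | (∑ F ∈ Finset.univ.filter (· ∉ T), l F) x =
        ∑ F ∈ Finset.univ.filter (· ∉ T), c F} := by
      ext x
      refine and_congr_right fun hx => ?_
      rw [hsum, Finset.sum_eq_sum_iff_of_le fun F _ => h.le F x hx]
      simp only [Finset.mem_filter, Finset.mem_univ, true_and, slack, sub_eq_zero]
      exact forall₂_congr fun F _ => eq_comm
    rw [this]
    refine IsExposed.of_forall_le fun x hx => ?_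
    rw [hsum]
    exact Finset.sum_le_sum fun F _ => h.le F x hx
  have hvert : vertexSet A = (fun v : vertexSet P => (v : Fin N → ℝ)) '' X := by
    rw [hP.vertexSet_of_isExposed hAexp]
    ext x
    constructor
    · rintro ⟨h1, h2⟩
      exact ⟨⟨x, h1⟩, h2.2, rfl⟩
    · rintro ⟨v, hv, rfl⟩
      exact ⟨v.2, vertexSet_subset v.2, hv⟩
  have hXne : X.Nonempty := by
    by_contra hc
    rw [not_nonempty_iff_eq_empty] at hc
    rw [hc, image_empty, Submodule.span_empty, finrank_bot] at hT
    omega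
  have hVne : (vertexSet A).Nonempty := hvert ▸ hXne.image _
  have hAP := hP.of_isExposed hAexp
  have himg : (fun v : vertexSet P => slack l c v) '' X = slack l c '' vertexSet A := by
    rw [hvert, image_image]
  rw [himg, h.finrank_span_slack hP hnt hVne (vertexSet_subset.trans hAexp.subset),
    hAP.pdim_vertexSet] at hT
  have := hs A hAexp (hVne.mono vertexSet_subset) (by omega)
  rwa [hvert, ncard_image_of_injective _ Subtype.val_injective] at this

end IsFacetSystem

theorem nontrivial_of_pdim_pos (h : 0 < pdim P) : P.Nontrivial := by
  by_contra hc
  rw [not_nontrivial_iff] at hc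
  rw [pdim_eq_finrank_vectorSpan, vectorSpan_of_subsingleton ℝ hc, finrank_bot] at h
  exact lt_irrefl _ h

theorem IsPolytope.pyramid_or_simplex_or (hP : IsPolytope P) (hs : TwoSimplicial P) {d : ℕ}
    (hd : 3 ≤ d) (hdim : pdim P = d) (hf : (facetSet P).ncard ≤ d + 3) :
    (∃ F v, IsFacetOf P F ∧ v ∈ P ∧ v ∉ F ∧ vertexSet P = insert v (vertexSet F)) ∨
      (vertexSet P).ncard = d + 1 ∨
      (d = 3 ∧ (facetSet P).ncard = 6 ∧ (vertexSet P).ncard = 5) := by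
  classical
  have hnt : P.Nontrivial := nontrivial_of_pdim_pos (by omega)
  have := hP.finite_facetSet.fintype
  have := hP.finite_vertexSet.fintype
  obtain ⟨l, c, h⟩ := hP.exists_isFacetSystem
  have hφ := h.isSlackMatrix hP hnt
  have hι : Fintype.card (facetSet P) = (facetSet P).ncard := by
    rw [← Nat.card_eq_fintype_card, Nat.card_coe_set_eq]
  have hκ : Fintype.card (vertexSet P) = (vertexSet P).ncard := by
    rw [← Nat.card_eq_fintype_card, Nat.card_coe_set_eq]
  rcases hφ.classification (h.triangularFaces hP hnt hs) hd
    (hdim ▸ h.finrank_span_range_slack hP hnt) (hι ▸ hf) with ⟨v, F, hvF⟩ | h1 | h1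
  · left
    have hF : IsFacetOf P F := F.2
    have hvP := vertexSet_subset v.2
    have hvnot : (v : Fin N → ℝ) ∉ (F : Set (Fin N → ℝ)) := fun hc => by
      refine hφ.ne_zero v (funext fun j => ?_)
      rcases eq_or_ne j F with rfl | hj
      · exact (h.slack_eq_zero hvP j).2 hc
      · exact hvF j hj
    refine ⟨F, v, hF, hvP, hvnot, ?_⟩
    rw [hP.vertexSet_of_isExposed hF.1]
    ext u
    constructor
    · intro hu
      by_cases huF : u ∈ (F : Set (Fin N → ℝ))
      · exact Or.inr ⟨hu, huF⟩
      · left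
        have := hφ.minimal v ⟨u, hu⟩ fun j hj => by
          rcases eq_or_ne j F with rfl | hne
          · exact absurd ((h.slack_eq_zero (vertexSet_subset hu) j).1 hj) huF
          · exact hvF j hne
        rw [this]
    · rintro (rfl | hu)
      · exact v.2
      · exact hu.1
  · right; left
    rw [← hκ, h1]
  · right; right
    exact ⟨h1.1, hι ▸ h1.2.1, hκ ▸ h1.2.2⟩

end Polytope

section Pyramid

variable {N : ℕ} {P F G : Set (Fin N → ℝ)} {v : Fin N → ℝ}

theorem notMem_affineSpan_of_isExposed (hF : IsExposed ℝ P F) (hv : v ∈ P) (hvF : v ∉ F) :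
    v ∉ affineSpan ℝ F := by
  intro hc
  have hne : F.Nonempty := (affineSpan_nonempty ℝ).1 ⟨v, hc⟩
  obtain ⟨l, m, -, he⟩ := hF.exists_forall_le hne
  refine hvF ?_
  rw [he]
  refine ⟨hv, map_eq_of_mem_affineSpan (F := F) (fun y hy => ?_) hc⟩
  rw [he] at hy
  exact hy.2

theorem convexHull_insert_inter_eq (hP : Convex ℝ P) (hF : IsExposed ℝ P F) (hv : v ∈ P)
    (hvF : v ∉ F) (hGF : G ⊆ F) (hG : Convex ℝ G) (hGne : G.Nonempty) :
    convexHull ℝ (insert v G) ∩ F = G := by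
  obtain ⟨l, m, hl, he⟩ := hF.exists_forall_le (hGne.mono hGF)
  have hsub : insert v G ⊆ P := insert_subset hv (hGF.trans hF.subset)
  have h1 := sep_eq_convexHull_of_forall_le (S := insert v G) fun s hs => hl s (hsub hs)
  have h2 : {s ∈ insert v G | l s = m} = G := by
    ext s
    constructor
    · rintro ⟨rfl | hs, hsm⟩
      · exact absurd (he ▸ ⟨hv, hsm⟩) hvF
      · exact hs
    · intro hs
      have := hGF hs
      rw [he] at this
      exact ⟨Or.inr hs, this.2⟩
  rw [h2, hG.convexHull_eq] at h1
  conv_rhs => rw [← h1]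
  ext x
  refine and_congr_right fun hx => ?_
  have hxP : x ∈ P := convexHull_min hsub hP hx
  rw [he]
  exact ⟨fun h => h.2, fun h => ⟨hxP, h⟩⟩

theorem isExposed_base_and_pyramid (hF : IsExposed ℝ P F) (hPF : P = convexHull ℝ (insert v F))
    (hvF : v ∉ F) (hG : IsExposed ℝ F G) (hGne : G.Nonempty) :
    IsExposed ℝ P (convexHull ℝ G) ∧ IsExposed ℝ P (convexHull ℝ (insert v G)) := by
  have hGF := hG.subset
  have hsubP : insert v F ⊆ P := by
    rw [hPF]
    exact subset_convexHull ℝ _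
  obtain ⟨l, m, hl, he⟩ := hF.exists_forall_le (hGne.mono hGF)
  obtain ⟨g, n, hg, hge⟩ := hG.exists_forall_le hGne
  have hlv : l v < m := lt_of_le_of_ne (hl v (hsubP (mem_insert _ _))) fun hc =>
    hvF (he ▸ ⟨hsubP (mem_insert _ _), hc⟩)
  have hlF : ∀ y ∈ F, l y = m := fun y hy => by
    rw [he] at hy
    exact hy.2
  have hGiff : ∀ y ∈ F, g y = n ↔ y ∈ G := fun y hy => by
    rw [hge]
    exact ⟨fun h => ⟨hy, h⟩, fun h => h.2⟩
  have key : ∀ M : ℝ, g v - n ≤ M * (m - l v) →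
      IsExposed ℝ P (convexHull ℝ {s ∈ insert v F | (g + M • l) s = n + M * m}) := by
    intro M hM
    have hle : ∀ s ∈ insert v F, (g + M • l) s ≤ n + M * m := by
      rintro s (rfl | hs)
      · simp only [add_apply, smul_apply, smul_eq_mul]
        linarith
      · simp only [add_apply, smul_apply, smul_eq_mul, hlF s hs]
        linarith [hg s hs]
    rw [← sep_eq_convexHull_of_forall_le hle, ← hPF]
    refine IsExposed.of_forall_le fun x hx => ?_
    rw [hPF] at hx
    exact le_of_mem_convexHull hle hx
  have hpos := sub_pos.2 hlv
  constructor
  · have hM : (g v - n) / (m - l v) * (m - l v) = g v - n := div_mul_cancel₀ _ hpos.ne'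
    convert key ((g v - n) / (m - l v) + 1) (by linarith) using 2
    ext s
    constructor
    · intro hs
      refine ⟨Or.inr (hGF hs), ?_⟩
      simp [hlF s (hGF hs), (hGiff s (hGF hs)).2 hs]
    · rintro ⟨rfl | hs, hs'⟩
      · simp only [add_apply, smul_apply, smul_eq_mul] at hs'
        linarith
      · simp only [add_apply, smul_apply, smul_eq_mul, hlF s hs, add_left_inj] at hs'
        exact (hGiff s hs).1 hs'
  · have hM : (g v - n) / (m - l v) * (m - l v) = g v - n := div_mul_cancel₀ _ hpos.ne'
    convert key ((g v - n) / (m - l v)) (by linarith) using 2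
    ext s
    constructor
    · rintro (rfl | hs)
      · refine ⟨mem_insert _ _, ?_⟩
        simp only [add_apply, smul_apply, smul_eq_mul]
        linarith
      · refine ⟨Or.inr (hGF hs), ?_⟩
        simp [hlF s (hGF hs), (hGiff s (hGF hs)).2 hs]
    · rintro ⟨rfl | hs, hs'⟩
      · exact mem_insert _ _
      · simp only [add_apply, smul_apply, smul_eq_mul, hlF s hs, add_left_inj] at hs'
        exact Or.inr ((hGiff s hs).1 hs')

theorem pdim_insert (hne : G.Nonempty) (hv : v ∉ affineSpan ℝ G) :
    pdim (insert v G) = pdim G + 1 := by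
  obtain ⟨p, hp⟩ := hne
  have hp' := subset_affineSpan ℝ G hp
  have hnot : v - p ∉ (affineSpan ℝ G).direction := fun hc => hv <| by
    simpa using AffineSubspace.vadd_mem_of_mem_direction hc hp'
  rw [pdim, ← affineSpan_insert_affineSpan, AffineSubspace.direction_affineSpan_insert hp', sup_comm,
    vsub_eq_sub, Submodule.finrank_sup_span_singleton hnot, pdim]

theorem TwoSimplicial.of_isExposed_base (hs : TwoSimplicial P) (hP : IsPolytope P)
    (hF : IsExposed ℝ P F) (hPF : P = convexHull ℝ (insert v F)) (hvF : v ∉ F) :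
    TwoSimplicial F := by
  intro G hG hGne hG2
  have h := (isExposed_base_and_pyramid hF hPF hvF hG hGne).1
  rw [((hG.convex (hF.convex hP.convex))).convexHull_eq] at h
  exact hs G h hGne hG2

theorem IsPolytope.ncard_facetSet_base_lt (hP : IsPolytope P) (hF : IsFacetOf P F)
    (hPF : P = convexHull ℝ (insert v F)) (hvF : v ∉ F) :
    (facetSet F).ncard < (facetSet P).ncard := by
  have hv : v ∈ P := by
    rw [hPF]
    exact subset_convexHull ℝ _ (mem_insert _ _)
  have hFc := hF.1.convex hP.convex
  set Φ : Set (Fin N → ℝ) → Set (Fin N → ℝ) := fun G => convexHull ℝ (insert v G) with hΦ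
  have h_inter : ∀ G ∈ facetSet F, Φ G ∩ F = G := fun G hG => by
    have hG : IsFacetOf F G := hG
    exact convexHull_insert_inter_eq hP.convex hF.1 hv hvF hG.1.subset (hG.1.convex hFc) hG.2.1
  have hinj : InjOn Φ (facetSet F) := fun G hG G' hG' h => by
    rw [← h_inter G hG, ← h_inter G' hG', h]
  have hsub : Φ '' facetSet F ⊆ facetSet P := by
    rintro _ ⟨G, hG, rfl⟩
    have hG : IsFacetOf F G := hG
    refine ⟨(isExposed_base_and_pyramid hF.1 hPF hvF hG.1 hG.2.1).2, ?_, ?_⟩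
    · exact convexHull_nonempty_iff.2 (insert_nonempty _ _)
    · have hvG : v ∉ affineSpan ℝ G := fun hc =>
        notMem_affineSpan_of_isExposed hF.1 hv hvF (affineSpan_mono ℝ hG.1.subset hc)
      rw [hΦ, pdim_convexHull, pdim_insert hG.2.1 hvG, hG.2.2, hF.2.2]
  have hnot : F ∉ Φ '' facetSet F := by
    rintro ⟨G, -, hG⟩
    exact hvF (hG ▸ subset_convexHull ℝ _ (mem_insert _ _))
  rw [← hinj.ncard_image]
  refine ncard_lt_ncard ?_ hP.finite_facetSet
  exact ⟨hsub, fun h => hnot (h hF)⟩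

theorem IsPolytope.isPyramidOver (hP : IsPolytope P) (hF : IsFacetOf P F) (hv : v ∈ P)
    (hvF : v ∉ F) (hvert : vertexSet P = insert v (vertexSet F)) :
    P = convexHull ℝ (insert v F) ∧ IsPyramidOver P F := by
  have h : P = convexHull ℝ (insert v F) := by
    apply Subset.antisymm
    · conv_lhs => rw [← hP.convexHull_vertexSet, hvert]
      exact convexHull_mono (insert_subset_insert vertexSet_subset)
    · exact convexHull_min (insert_subset hv hF.1.subset) hP.convex
  refine ⟨h, hF, v, notMem_affineSpan_of_isExposed hF.1 hv hvF, ?_⟩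
  rwa [union_singleton]

end Pyramid

/-- For every integer `d ≥ 3`, a 2-simplicial `d`-polytope with at most `d + 3`
facets is a `d`-simplex (it has exactly `d + 1` vertices) or a `(d - 3)`-fold pyramid over a
triangular bipyramid (a 3-polytope with exactly 5 vertices and exactly 6 facets, all of whose
facets are triangles). -/
theorem two_simplicial_few_facets_classification
    (d : ℕ) (hd : 3 ≤ d) {N : ℕ} (P : Set (Fin N → ℝ))
    (hP : IsPolytope P) (hdim : pdim P = d) (hs : TwoSimplicial P)
    (hf : (facetSet P).ncard ≤ d + 3) :
    (vertexSet P).ncard = d + 1 ∨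
    ∃ Q : Set (Fin N → ℝ), IsPolytope Q ∧ pdim Q = 3 ∧
      (vertexSet Q).ncard = 5 ∧ (facetSet Q).ncard = 6 ∧
      (∀ F, IsFacetOf Q F → (vertexSet F).ncard = 3) ∧
      IsKFoldPyramidOver (d - 3) P Q := by
  induction d using Nat.strong_induction_on generalizing P with
  | _ d ih =>
    rcases hP.pyramid_or_simplex_or hs hd hdim hf with ⟨F, v, hF, hv, hvF, hvert⟩ | h | ⟨rfl, h⟩
    · obtain ⟨hPF, hpyr⟩ := hP.isPyramidOver hF hv hvF hvert
      have hFP := hP.of_isExposed hF.1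
      have hFs := hs.of_isExposed_base hP hF.1 hPF hvF
      have hcard : (vertexSet P).ncard = (vertexSet F).ncard + 1 := by
        rw [hvert, ncard_insert_of_notMem (fun h => hvF (vertexSet_subset h))
          hFP.finite_vertexSet]
      have hlt := hP.ncard_facetSet_base_lt hF hPF hvF
      have hFdim := hF.2.2
      rcases eq_or_lt_of_le hd with rfl | hd'
      · left
        rw [hcard, hs F hF.1 hF.2.1 (by omega)]
      · obtain ⟨e, rfl⟩ : ∃ e, d = e + 1 := ⟨d - 1, by omega⟩
        rcases ih e (by omega) (by omega) F hFP (by omega) hFs (by omega) with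
          h | ⟨Q, hQ, hQ3, hQ5, hQ6, hQt, hk⟩
        · left
          rw [hcard, h]
        · right
          refine ⟨Q, hQ, hQ3, hQ5, hQ6, hQt, ?_⟩
          rw [show e + 1 - 3 = (e - 3) + 1 by omega]
          exact ⟨F, hk, hpyr⟩
    · exact Or.inl h
    · refine Or.inr ⟨P, hP, hdim, h.2, h.1, fun F hF => hs F hF.1 hF.2.1 ?_, rfl⟩
      have := hF.2.2
      omega
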